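/- arXiv:1007.0549 — 9 statements merged into one kernel-verified Lean document; each statement's English description precedes it below -/
import Mathlib

section
/- Let (X, 𝒜, μ) be a σ-finite measure space and let p, q be probability densities on X with respect to μ (nonnegative, measurable, integrating to 1). Then for every n ≥ 1, ∫_{Xⁿ} min(∏_{j=1}^n p(xⱼ), ∏_{j=1}^n q(xⱼ)) dμⁿ(x) ≥ (1/8) · (1 − (1/2) ∫_X |p − q| dμ)^{2n}, where μⁿ denotes the n-fold product measure. -/
open MeasureTheory ENNReal

theorem lintegral_fin_prod_aux {X : Type*} [MeasurableSpace X] (μ : Measure X) [SigmaFinite μ]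
    (f : X → ℝ≥0∞) (hf : Measurable f) (n : ℕ) :
    ∫⁻ x, ∏ j, f (x j) ∂(Measure.pi fun _ : Fin n => μ) = (∫⁻ x, f x ∂μ) ^ n := by
  induction n with
  | zero => simp
  | succ n ih =>
    have hm : Measurable fun x : Fin n → X => ∏ j, f (x j) := by fun_prop
    have hm' : Measurable fun x : Fin (n+1) → X => ∏ j, f (x j) := by fun_prop
    rw [← ((measurePreserving_piFinSuccAbove (fun _ : Fin (n+1) => μ) 0).symm).lintegral_comp hm']
    simp_rw [MeasurableEquiv.piFinSuccAbove_symm_apply, Fin.insertNthEquiv,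
      Fin.prod_univ_succ, Fin.insertNth_zero, Equiv.coe_fn_mk, Fin.cons_succ, Fin.cons_zero]
    rw [pow_succ', ← ih]
    exact lintegral_prod_mul hf.aemeasurable hm.aemeasurable

/-- **Product affinity bound.** If `p, q` are probability densities with respect to a σ-finite
measure `μ`, then the affinity of the `n`-fold products satisfies
`∫ min(∏ⱼ p(xⱼ), ∏ⱼ q(xⱼ)) dμⁿ ≥ (1/8) (1 - (1/2)∫|p - q| dμ)^{2n}`.
Here `|p - q|` is expressed in `ℝ≥0∞` as `(p - q) + (q - p)` (truncated subtraction). -/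
theorem affinity_product_lower_bound
    {X : Type*} [MeasurableSpace X] (μ : Measure X) [SigmaFinite μ]
    (p q : X → ℝ≥0∞) (hp : Measurable p) (hq : Measurable q)
    (hp1 : ∫⁻ x, p x ∂μ = 1) (hq1 : ∫⁻ x, q x ∂μ = 1)
    (n : ℕ) (hn : 1 ≤ n) :
    (1 / 8 : ℝ≥0∞) *
        (1 - (1 / 2 : ℝ≥0∞) * ∫⁻ x, (p x - q x) + (q x - p x) ∂μ) ^ (2 * n) ≤
      ∫⁻ x, min (∏ j, p (x j)) (∏ j, q (x j)) ∂(Measure.pi fun _ : Fin n => μ) := by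
  set a := ∫⁻ x, min (p x) (q x) ∂μ with ha
  have m1 : Measurable fun x => p x - q x := hp.sub hq
  have m2 : Measurable fun x => q x - p x := hq.sub hp
  have h1 : ∫⁻ x, (p x - q x) ∂μ + a = 1 := by
    rw [ha, ← lintegral_add_left m1, ← hp1]
    simp only [tsub_add_min]
  have h2 : ∫⁻ x, (q x - p x) ∂μ + a = 1 := by
    rw [ha, ← lintegral_add_left m2, ← hq1]
    exact lintegral_congr fun x => by rw [min_comm, tsub_add_min]
  have ha1 : a ≤ 1 := h1 ▸ le_add_self
  have hat : a ≠ ⊤ := ne_top_of_le_ne_top one_ne_top ha1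
  have h3 : (1 : ℝ≥0∞) - (1 / 2 : ℝ≥0∞) * ∫⁻ x, (p x - q x) + (q x - p x) ∂μ = a := by
    rw [lintegral_add_left m1, ENNReal.eq_sub_of_add_eq hat h1,
      ENNReal.eq_sub_of_add_eq hat h2, ← two_mul, ← mul_assoc, one_div,
      ENNReal.inv_mul_cancel (by simp) (by simp), one_mul]
    exact ENNReal.sub_sub_cancel one_ne_top ha1
  rw [h3]
  calc (1 / 8 : ℝ≥0∞) * a ^ (2 * n) ≤ 1 * a ^ n := by
        gcongr ?_ * ?_
        · simp [ENNReal.inv_le_one]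
        · exact pow_le_pow_of_le_one (zero_le) ha1 (by omega)
    _ = ∫⁻ x, ∏ j, min (p (x j)) (q (x j)) ∂(Measure.pi fun _ : Fin n => μ) := by
        rw [one_mul, lintegral_fin_prod_aux μ (fun x => min (p x) (q x)) (hp.min hq)]
    _ ≤ _ := by
        refine lintegral_mono fun x => le_min ?_ ?_
        · exact Finset.prod_le_prod' fun j _ => min_le_left _ _
        · exact Finset.prod_le_prod' fun j _ => min_le_right _ _
end

section
/- Let (X, 𝒜, μ) be a σ-finite measure space and let ℓ, p, u : X → [0, ∞) be measurable functions with ℓ ≤ p ≤ u pointwise μ-almost everywhere, u integrable, and ∫_X p dμ = 1. Define the Hellinger distance h(f, g) = (∫_X (√f − √g)² dμ)^{1/2} and set δ = h(ℓ, u). If δ ≤ 1, then h(p, u / ∫_X u dμ) ≤ 4 δ. -/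
open MeasureTheory

/-- The Hellinger distance `h(f,g) = (∫ (√f - √g)² dμ)^{1/2}` between two nonnegative
functions `f, g` on a measure space `(X, μ)`. -/
noncomputable def hellingerDist {X : Type*} [MeasurableSpace X] (μ : Measure X)
    (f g : X → ℝ) : ℝ :=
  Real.sqrt (∫ x, (Real.sqrt (f x) - Real.sqrt (g x)) ^ 2 ∂μ)

/-- **Normalized upper bracket is Hellinger-close to the bracketed density.**
If `ℓ ≤ p ≤ u` a.e., `u` is integrable, `p` is a probability density, and
`δ = h(ℓ, u) ≤ 1`, then `h(p, u/∫u) ≤ 4δ`. -/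
theorem hellinger_bracket_normalization
    {X : Type*} [MeasurableSpace X] (μ : Measure X) [SigmaFinite μ]
    (ℓ p u : X → ℝ) (hℓm : Measurable ℓ) (hpm : Measurable p) (hum : Measurable u)
    (hℓ0 : ∀ x, 0 ≤ ℓ x)
    (hℓp : ∀ᵐ x ∂μ, ℓ x ≤ p x) (hpu : ∀ᵐ x ∂μ, p x ≤ u x)
    (hu : Integrable u μ) (hp1 : ∫ x, p x ∂μ = 1)
    (hδ : hellingerDist μ ℓ u ≤ 1) :
    hellingerDist μ p (fun x => u x / ∫ y, u y ∂μ) ≤ 4 * hellingerDist μ ℓ u := by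
  have hpi : Integrable p μ := by
    by_contra h
    rw [integral_undef h] at hp1
    exact zero_ne_one hp1
  have hU : 1 ≤ ∫ y, u y ∂μ := by
    rw [← hp1]
    exact integral_mono_ae hpi hu hpu
  set U := ∫ y, u y ∂μ with hUdef
  have hs1 : 1 ≤ Real.sqrt U := Real.one_le_sqrt.mpr hU
  have hss : Real.sqrt U ^ 2 = U := Real.sq_sqrt (by linarith)
  set s := Real.sqrt U with hsdef
  have hs0 : 0 < s := by linarith
  have hi1 : Integrable (fun x => (Real.sqrt (p x) - Real.sqrt (u x)) ^ 2) μ := by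
    refine hu.mono' (by fun_prop) ?_
    filter_upwards [hℓp, hpu] with x h1 h2
    have h0 := hℓ0 x
    have := Real.sqrt_le_sqrt h2
    have := Real.sqrt_nonneg (p x)
    have := Real.sq_sqrt (show 0 ≤ u x by linarith)
    rw [Real.norm_of_nonneg (sq_nonneg _)]
    nlinarith
  have hi2 : Integrable (fun x => (Real.sqrt (ℓ x) - Real.sqrt (u x)) ^ 2) μ := by
    refine hu.mono' (by fun_prop) ?_
    filter_upwards [hℓp, hpu] with x h1 h2
    have h0 := hℓ0 x
    have := Real.sqrt_le_sqrt (h1.trans h2)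
    have := Real.sqrt_nonneg (ℓ x)
    have := Real.sq_sqrt (show 0 ≤ u x by linarith)
    rw [Real.norm_of_nonneg (sq_nonneg _)]
    nlinarith
  have hA : ∫ x, (Real.sqrt (p x) - Real.sqrt (u x)) ^ 2 ∂μ
      ≤ ∫ x, (Real.sqrt (ℓ x) - Real.sqrt (u x)) ^ 2 ∂μ := by
    refine integral_mono_ae hi1 hi2 ?_
    filter_upwards [hℓp, hpu] with x h1 h2
    have := Real.sqrt_le_sqrt h1
    have := Real.sqrt_le_sqrt h2
    show (Real.sqrt (p x) - Real.sqrt (u x)) ^ 2 ≤ (Real.sqrt (ℓ x) - Real.sqrt (u x)) ^ 2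
    nlinarith
  have hA0 : 0 ≤ ∫ x, (Real.sqrt (p x) - Real.sqrt (u x)) ^ 2 ∂μ :=
    integral_nonneg fun x => sq_nonneg _
  have hH : ∫ x, (Real.sqrt (p x) - Real.sqrt (u x / U)) ^ 2 ∂μ
      = s⁻¹ * (∫ x, (Real.sqrt (p x) - Real.sqrt (u x)) ^ 2 ∂μ)
        + (1 - s⁻¹) * 1 + (s⁻¹ ^ 2 - s⁻¹) * U := by
    have hc : (fun x => (Real.sqrt (p x) - Real.sqrt (u x / U)) ^ 2) =ᵐ[μ]
        fun x => (s⁻¹ * (Real.sqrt (p x) - Real.sqrt (u x)) ^ 2 + (1 - s⁻¹) * p x)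
          + (s⁻¹ ^ 2 - s⁻¹) * u x := by
      filter_upwards [hℓp, hpu] with x h1 h2
      have h0 := hℓ0 x
      have e1 := Real.sq_sqrt (show 0 ≤ u x by linarith)
      have e2 := Real.sq_sqrt (show 0 ≤ p x by linarith)
      rw [Real.sqrt_div (by linarith), ← hsdef, div_eq_mul_inv]
      generalize Real.sqrt (u x) = a at *
      generalize Real.sqrt (p x) = b at *
      rw [← e1, ← e2]
      ring
    · have hj : Integrable (fun x => s⁻¹ * (Real.sqrt (p x) - Real.sqrt (u x)) ^ 2
          + (1 - s⁻¹) * p x) μ := (hi1.const_mul _).add (hpi.const_mul _)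
      rw [integral_congr_ae hc, integral_add hj (hu.const_mul _),
        integral_add (hi1.const_mul _) (hpi.const_mul _), integral_const_mul,
        integral_const_mul, integral_const_mul, hp1]
  have hle : ∫ x, (Real.sqrt (p x) - Real.sqrt (u x / U)) ^ 2 ∂μ
      ≤ ∫ x, (Real.sqrt (p x) - Real.sqrt (u x)) ^ 2 ∂μ := by
    rw [hH, ← hss]
    generalize (∫ x, (Real.sqrt (p x) - Real.sqrt (u x)) ^ 2 ∂μ) = A at *
    have e : s⁻¹ * A + (1 - s⁻¹) * 1 + (s⁻¹ ^ 2 - s⁻¹) * s ^ 2 = (A - (s - 1) ^ 2) / s := by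
      field_simp
      ring
    rw [e, div_le_iff₀ hs0]
    nlinarith [sq_nonneg (s - 1)]
  have hfin : hellingerDist μ p (fun x => u x / U) ≤ hellingerDist μ ℓ u :=
    Real.sqrt_le_sqrt (hle.trans hA)
  have : 0 ≤ hellingerDist μ ℓ u := Real.sqrt_nonneg _
  linarith
end

section
/- Fix integers 1 ≤ d < D, a real κ > 0, and 0 < γ < κ with √(4κγ − γ²) ≤ 1. For the sets M₀ and M₁ of the bump construction, the Hausdorff distance satisfies H(M₀, M₁) = γ. -/
open Metric

open Metric

/-- The point `(u, v, 0) ∈ ℝ^D`, where the first `d` coordinates are those of `u`,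
the `(d+1)`-st coordinate is `v`, and the remaining `D - d - 1` coordinates vanish. -/
noncomputable def bumpPt (d D : ℕ) (u : EuclideanSpace ℝ (Fin d)) (v : ℝ) :
    EuclideanSpace ℝ (Fin D) :=
  (WithLp.equiv 2 ((_ : Fin D) → ℝ)).symm
    (fun i => if h : (i : ℕ) < d then u ⟨i, h⟩ else if (i : ℕ) = d then v else 0)

/-- The profile function `a(u)` of the unperturbed manifold `M₀`. -/
noncomputable def bumpA (d : ℕ) (κ : ℝ) (u : EuclideanSpace ℝ (Fin d)) : ℝ :=
  if ‖u‖ ≤ 1 then κ else Real.sqrt (κ ^ 2 - (‖u‖ - 1) ^ 2)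

/-- The profile function `b(u)` of the perturbed manifold `M₁`, with bump height `γ`. -/
noncomputable def bumpB (d : ℕ) (κ γ : ℝ) (u : EuclideanSpace ℝ (Fin d)) : ℝ :=
  if ‖u‖ ≤ Real.sqrt (4 * κ * γ - γ ^ 2) / 2 then γ + Real.sqrt (κ ^ 2 - ‖u‖ ^ 2)
  else if ‖u‖ ≤ Real.sqrt (4 * κ * γ - γ ^ 2) then
    2 * κ - Real.sqrt (κ ^ 2 - (‖u‖ - Real.sqrt (4 * κ * γ - γ ^ 2)) ^ 2)
  else bumpA d κ u

/-- The manifold `M₀` of the bump construction. -/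
noncomputable def bumpM₀ (d D : ℕ) (κ : ℝ) : Set (EuclideanSpace ℝ (Fin D)) :=
  {y | ∃ u : EuclideanSpace ℝ (Fin d), ‖u‖ ≤ 1 + κ ∧
    (y = bumpPt d D u (bumpA d κ u) ∨ y = bumpPt d D u (-bumpA d κ u))}

/-- The perturbed manifold `M₁` of the bump construction. -/
noncomputable def bumpM₁ (d D : ℕ) (κ γ : ℝ) : Set (EuclideanSpace ℝ (Fin D)) :=
  {y | ∃ u : EuclideanSpace ℝ (Fin d), ‖u‖ ≤ 1 + κ ∧
    (y = bumpPt d D u (bumpB d κ γ u) ∨ y = bumpPt d D u (-bumpA d κ u))}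

theorem bumpPt_dist (d D : ℕ) (hdD : d < D) (u : EuclideanSpace ℝ (Fin d)) (v w : ℝ) :
    dist (bumpPt d D u v) (bumpPt d D u w) = |v - w| := by
  have h : bumpPt d D u v - bumpPt d D u w = EuclideanSpace.single (⟨d, hdD⟩ : Fin D) (v - w) := by
    ext i
    by_cases h1 : (i : ℕ) < d
    · have : i ≠ ⟨d, hdD⟩ := by
        intro h
        rw [h] at h1
        simp at h1
      simp [bumpPt, h1, this]
    · by_cases h2 : (i : ℕ) = d
      · have : i = ⟨d, hdD⟩ := Fin.ext h2
        simp [bumpPt, this]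
      · have : i ≠ ⟨d, hdD⟩ := fun h => h2 (by rw [h])
        simp [bumpPt, h1, h2, this]
  rw [dist_eq_norm, h, EuclideanSpace.norm_single, Real.norm_eq_abs]

theorem bumpPt_coord (d D : ℕ) (hdD : d < D) (u : EuclideanSpace ℝ (Fin d)) (v : ℝ) :
    bumpPt d D u v ⟨d, hdD⟩ = v := by
  simp [bumpPt]

theorem bumpA_bounds (d : ℕ) (κ : ℝ) (hκ : 0 < κ) (u : EuclideanSpace ℝ (Fin d)) :
    0 ≤ bumpA d κ u ∧ bumpA d κ u ≤ κ := by
  unfold bumpA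
  split_ifs
  · exact ⟨hκ.le, le_rfl⟩
  · refine ⟨Real.sqrt_nonneg _, ?_⟩
    rw [Real.sqrt_le_left hκ.le]
    nlinarith [sq_nonneg (‖u‖ - 1)]

theorem bumpB_bounds (d : ℕ) (κ γ : ℝ) (hκ : 0 < κ) (hγ : 0 < γ) (hγκ : γ < κ)
    (hr : Real.sqrt (4 * κ * γ - γ ^ 2) ≤ 1) (u : EuclideanSpace ℝ (Fin d)) :
    |bumpA d κ u - bumpB d κ γ u| ≤ γ := by
  have hs : Real.sqrt (4 * κ * γ - γ ^ 2) ^ 2 = 4 * κ * γ - γ ^ 2 :=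
    Real.sq_sqrt (by nlinarith)
  have h0 := Real.sqrt_nonneg (4 * κ * γ - γ ^ 2)
  have hu := norm_nonneg u
  unfold bumpB
  generalize Real.sqrt (4 * κ * γ - γ ^ 2) = r at *
  have key : ∀ t : ℝ, t ^ 2 ≤ (r / 2) ^ 2 →
      κ - γ / 2 ≤ Real.sqrt (κ ^ 2 - t ^ 2) ∧ Real.sqrt (κ ^ 2 - t ^ 2) ≤ κ := by
    intro t ht
    constructor
    · apply Real.le_sqrt_of_sq_le
      nlinarith
    · rw [Real.sqrt_le_left hκ.le]
      nlinarith [sq_nonneg t]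
  split_ifs with h1 h2
  · have ha : bumpA d κ u = κ := if_pos (by linarith)
    obtain ⟨k1, k2⟩ := key ‖u‖ (by nlinarith)
    rw [ha, abs_le]
    constructor <;> linarith
  · have ha : bumpA d κ u = κ := if_pos (by linarith)
    obtain ⟨k1, k2⟩ := key (‖u‖ - r) (by nlinarith)
    rw [ha, abs_le]
    constructor <;> linarith
  · simpa using hγ.le

/-- **Hausdorff distance of the bump construction (Theorem 5, part 2).**
For `1 ≤ d < D`, `κ > 0`, `0 < γ < κ` with `√(4κγ - γ²) ≤ 1`, the sets `M₀` and `M₁`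
of the bump construction satisfy `H(M₀, M₁) = γ`. -/
theorem bump_hausdorffDist (d D : ℕ) (hd : 1 ≤ d) (hdD : d < D)
    (κ γ : ℝ) (hκ : 0 < κ) (hγ : 0 < γ) (hγκ : γ < κ)
    (hr : Real.sqrt (4 * κ * γ - γ ^ 2) ≤ 1) :
    Metric.hausdorffDist (bumpM₀ d D κ) (bumpM₁ d D κ γ) = γ := by
  have hE : Metric.hausdorffEDist (bumpM₀ d D κ) (bumpM₁ d D κ γ) ≤ ENNReal.ofReal γ := by
    apply Metric.hausdorffEDist_le_of_mem_edist
    · rintro y ⟨u, hu, rfl | rfl⟩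
      · refine ⟨_, ⟨u, hu, Or.inl rfl⟩, ?_⟩
        rw [edist_dist, bumpPt_dist d D hdD]
        exact ENNReal.ofReal_le_ofReal (bumpB_bounds d κ γ hκ hγ hγκ hr u)
      · refine ⟨_, ⟨u, hu, Or.inr rfl⟩, ?_⟩
        simp
    · rintro y ⟨u, hu, rfl | rfl⟩
      · refine ⟨_, ⟨u, hu, Or.inl rfl⟩, ?_⟩
        rw [edist_dist, bumpPt_dist d D hdD, abs_sub_comm]
        exact ENNReal.ofReal_le_ofReal (bumpB_bounds d κ γ hκ hγ hγκ hr u)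
      · refine ⟨_, ⟨u, hu, Or.inr rfl⟩, ?_⟩
        simp
  apply le_antisymm
  · exact ENNReal.toReal_le_of_le_ofReal hγ.le hE
  · by_contra! hlt
    have hmem : bumpPt d D 0 (bumpB d κ γ 0) ∈ bumpM₁ d D κ γ :=
      ⟨0, by simp; linarith, Or.inl rfl⟩
    have hb : bumpB d κ γ 0 = γ + κ := by
      unfold bumpB
      rw [if_pos (by rw [norm_zero]; positivity)]
      simp [Real.sqrt_sq hκ.le]
    obtain ⟨y, hy, hyd⟩ := Metric.exists_dist_lt_of_hausdorffDist_lt' hmem hlt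
      (ne_top_of_le_ne_top ENNReal.ofReal_ne_top hE)
    have hyc : y ⟨d, hdD⟩ ≤ κ := by
      obtain ⟨u, hu, rfl | rfl⟩ := hy
      · rw [bumpPt_coord]
        exact (bumpA_bounds d κ hκ u).2
      · rw [bumpPt_coord]
        linarith [(bumpA_bounds d κ hκ u).1]
    have hn := PiLp.norm_apply_le (y - bumpPt d D 0 (bumpB d κ γ 0)) ⟨d, hdD⟩
    rw [← dist_eq_norm, PiLp.sub_apply, bumpPt_coord, hb, Real.norm_eq_abs] at hn
    rw [hb] at hyd
    have := neg_abs_le (y ⟨d, hdD⟩ - (γ + κ))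
    linarith
end

section
/- Fix integers 1 ≤ d < D, a real κ > 0, and 0 < γ < κ with √(4κγ − γ²) ≤ 1. For the sets M₀ and M₁ of the bump construction and each i ∈ {0, 1}: for every x ∈ ℝ^D with infDist(x, Mᵢ) < κ there exists a unique point y ∈ Mᵢ such that dist(x, y) = infDist(x, Mᵢ). -/
open Metric

open Metric

theorem bump_abstract {F : Type*} [NormedAddCommGroup F] [InnerProductSpace ℝ F]
    (S I X : Set F) (κ : ℝ) (hκ : 0 < κ) (hI : IsOpen I) (hX : IsOpen X)
    (hIX : ∀ q, q ∈ I → q ∈ X → False) (hS : ∀ q, q ∉ S → q ∈ I ∨ q ∈ X)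
    (hn : ∀ y ∈ S, ∃ n : F, ‖n‖ = κ ∧ (∀ q ∈ ball (y + n) κ, q ∈ I ∧ q ∉ S) ∧
      (∀ q ∈ ball (y - n) κ, q ∈ X ∧ q ∉ S))
    (p y y' : F) (hy : y ∈ S) (hy' : y' ∈ S) (hmin : ∀ q ∈ S, dist p y ≤ dist p q)
    (heq : dist p y' = dist p y) (hlt : dist p y < κ) : y = y' := by
  obtain ⟨n, hnn, hin, hout⟩ := hn y hy
  rcases (dist_nonneg (x := p) (y := y)).eq_or_lt with h0 | h0
  · have h1 : p = y := dist_eq_zero.1 h0.symm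
    have h2 : p = y' := dist_eq_zero.1 (heq.trans h0.symm)
    exact h1.symm.trans h2
  set ρ := dist p y with hρ
  have hsub : ball p ρ ⊆ I ∪ X := by
    intro q hq
    apply hS
    intro hqS
    have := hmin q hqS
    rw [mem_ball, dist_comm] at hq
    linarith
  have key : ∀ m : F, ‖m‖ = κ → (∀ q ∈ ball (y + m) κ, q ∉ S) →
      Disjoint (ball p ρ) (ball (y - m) κ) → y = y' := by
    intro m hm hmS hdis
    have h1 := (disjoint_ball_ball_iff h0 hκ).1 hdis
    have h2 : ‖(p - y) + m‖ = ‖p - y‖ + ‖m‖ := by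
      apply le_antisymm (norm_add_le _ _)
      rw [hm, ← dist_eq_norm, ← hρ]
      rw [dist_eq_norm] at h1
      have h1' : p - y + m = p - (y - m) := by abel
      rw [h1']
      exact h1
    have h3 : SameRay ℝ (p - y) m := sameRay_iff_norm_add.2 h2
    have h4 := h3.norm_smul_eq
    rw [← dist_eq_norm, ← hρ, hm] at h4
    have h5 : ρ ^ 2 = ‖p - y'‖ ^ 2 := by rw [← dist_eq_norm, heq]
    have h6 : κ ≤ ‖y' - (y + m)‖ := by
      by_contra hc
      refine hmS y' ?_ hy'
      rw [mem_ball, dist_eq_norm]; linarith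
    have h7 : p - y = (ρ / κ) • m := by
      rw [div_eq_inv_mul, mul_smul, h4, smul_smul, inv_mul_cancel₀ hκ.ne', one_smul]
    have h8 : p - y' = (ρ / κ) • m - (y' - y) := by rw [← h7]; abel
    have h9 : y' - (y + m) = (y' - y) - m := by abel
    rw [h8, norm_sub_sq_real, norm_smul, inner_smul_left, hm] at h5
    rw [h9] at h6
    have h10 : κ ^ 2 ≤ ‖(y' - y) - m‖ ^ 2 := by gcongr
    rw [norm_sub_sq_real, hm, real_inner_comm] at h10
    have ht : ρ / κ < 1 := (div_lt_one hκ).2 hlt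
    have ht0 : 0 < ρ / κ := div_pos h0 hκ
    have h11 : (‖ρ / κ‖ * κ) ^ 2 = ρ ^ 2 := by
      rw [Real.norm_of_nonneg ht0.le, div_mul_cancel₀ _ hκ.ne']
    rw [h11] at h5
    simp only [conj_trivial] at h5
    set t := ρ / κ
    have h12 : (1 - t) * ‖y' - y‖ ^ 2 ≤ 0 := by nlinarith
    have h13 : ‖y' - y‖ ^ 2 ≤ 0 := by
      by_contra hc
      push Not at hc
      nlinarith [mul_pos (sub_pos.2 ht) hc]
    have h14 : ‖y' - y‖ = 0 := by nlinarith [norm_nonneg (y' - y), sq_nonneg ‖y' - y‖]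
    exact (sub_eq_zero.1 (norm_eq_zero.1 h14)).symm
  have hconn : IsPreconnected (ball p ρ) := (convex_ball p ρ).isPreconnected
  have hcase : ball p ρ ⊆ I ∨ ball p ρ ⊆ X := by
    by_cases h : (ball p ρ ∩ I).Nonempty
    · by_cases h' : (ball p ρ ∩ X).Nonempty
      · obtain ⟨q, hq, hqI, hqX⟩ := hconn I X hI hX hsub h h'
        exact (hIX q hqI hqX).elim
      · left
        intro q hq
        rcases hsub hq with h1 | h1
        · exact h1
        · exact (h' ⟨q, hq, h1⟩).elim
    · right
      intro q hq
      rcases hsub hq with h1 | h1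
      · exact (h ⟨q, hq, h1⟩).elim
      · exact h1
  rcases hcase with h | h
  · refine key n hnn (fun q hq => (hin q hq).2) ?_
    rw [Set.disjoint_left]
    intro q hq hq'
    exact hIX q (h hq) (hout q hq').1
  · refine key (-n) (by rw [norm_neg, hnn]) (fun q hq => (hout q (by rwa [sub_eq_add_neg])).2) ?_
    rw [Set.disjoint_left]
    intro q hq hq'
    exact hIX q (hin q (by rwa [sub_neg_eq_add] at hq')).1 (h hq)

noncomputable def bpA (κ ρ : ℝ) : ℝ := if ρ ≤ 1 then κ else Real.sqrt (κ ^ 2 - (ρ - 1) ^ 2)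

noncomputable def bpB (κ γ r ρ : ℝ) : ℝ :=
  if ρ ≤ r / 2 then γ + Real.sqrt (κ ^ 2 - ρ ^ 2)
  else if ρ ≤ r then 2 * κ - Real.sqrt (κ ^ 2 - (ρ - r) ^ 2)
  else bpA κ ρ

theorem bpA_cont (κ : ℝ) (hκ : 0 < κ) : Continuous (bpA κ) := by
  unfold bpA
  refine Continuous.if_le (by fun_prop) (by fun_prop) (by fun_prop) (by fun_prop) ?_
  intro x hx
  subst hx
  simp [Real.sqrt_sq hκ.le]

theorem bp_sqrt (κ γ r : ℝ) (hγκ : γ < κ) (hγ : 0 ≤ γ) (h : r ^ 2 = 4 * κ * γ - γ ^ 2) :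
    Real.sqrt (κ ^ 2 - (r / 2) ^ 2) = κ - γ / 2 := by
  rw [show κ ^ 2 - (r / 2) ^ 2 = (κ - γ / 2) ^ 2 by nlinarith]
  exact Real.sqrt_sq (by linarith)

theorem bpB_cont (κ γ r : ℝ) (hκ : 0 < κ) (hγκ : γ < κ) (hγ : 0 ≤ γ) (hr : 0 ≤ r) (hr1 : r ≤ 1)
    (h : r ^ 2 = 4 * κ * γ - γ ^ 2) : Continuous (bpB κ γ r) := by
  unfold bpB
  refine Continuous.if_le (by fun_prop) ?_ (by fun_prop) (by fun_prop) ?_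
  · refine Continuous.if_le (by fun_prop) (bpA_cont κ hκ) (by fun_prop) (by fun_prop) ?_
    intro x hx
    subst hx
    simp [Real.sqrt_sq hκ.le, bpA, hr1]
    ring
  · intro x hx
    subst hx
    rw [if_pos (by linarith), show r / 2 - r = -(r / 2) by ring, neg_sq, bp_sqrt κ γ r hγκ hγ h]
    ring

theorem bpA_nonneg (κ ρ : ℝ) (hκ : 0 < κ) : 0 ≤ bpA κ ρ := by
  unfold bpA; split_ifs
  · exact hκ.le
  · positivity

theorem bp_cap (κ γ r ρ : ℝ) (hγκ : γ < κ) (hγ : 0 ≤ γ) 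
    (h : r ^ 2 = 4 * κ * γ - γ ^ 2) (hρ : ρ ^ 2 ≤ (r / 2) ^ 2) :
    κ - γ / 2 ≤ Real.sqrt (κ ^ 2 - ρ ^ 2) := by
  rw [← bp_sqrt κ γ r hγκ hγ h]
  apply Real.sqrt_le_sqrt
  linarith

theorem bp_sqrt_le (κ ρ : ℝ) (hκ : 0 < κ) : Real.sqrt (κ ^ 2 - ρ ^ 2) ≤ κ := by
  rw [Real.sqrt_le_left hκ.le]
  nlinarith [sq_nonneg ρ]

theorem bpA_le_bpB (κ γ r ρ : ℝ) (hκ : 0 < κ) (hγκ : γ < κ) (hγ : 0 ≤ γ) (hr : 0 ≤ r) (hr1 : r ≤ 1)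
    (h : r ^ 2 = 4 * κ * γ - γ ^ 2) (hρ : 0 ≤ ρ) : bpA κ ρ ≤ bpB κ γ r ρ := by
  unfold bpB
  split_ifs with h1 h2
  · have := bp_cap κ γ r ρ hγκ hγ h (by gcongr)
    rw [bpA, if_pos (by linarith)]
    linarith
  · have := bp_sqrt_le κ (ρ - r) hκ
    rw [bpA, if_pos (by linarith)]
    linarith
  · exact le_rfl

/-- in-ball, lower part -/
theorem bp_in_low (κ s h ρ v : ℝ) (hκ : 0 < κ) (hs1 : s ≤ 1) (hh : 0 ≤ h) (hρ : 0 ≤ ρ)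
    (hq : (ρ - s) ^ 2 + (v - h) ^ 2 < κ ^ 2) : ρ < 1 + κ ∧ -bpA κ ρ < v := by
  have h1 : ρ - s < κ := by
    apply lt_of_pow_lt_pow_left₀ 2 hκ.le; nlinarith [sq_nonneg (v - h)]
  refine ⟨by linarith, ?_⟩
  unfold bpA
  split_ifs with hc
  · have : h - v < κ := by
      apply lt_of_pow_lt_pow_left₀ 2 hκ.le; nlinarith [sq_nonneg (ρ - s)]
    linarith
  · push Not at hc
    have : |h - v| < Real.sqrt (κ ^ 2 - (ρ - 1) ^ 2) := by
      apply Real.lt_sqrt_of_sq_lt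
      rw [sq_abs]; nlinarith
    have := (abs_lt.1 this).2
    linarith

theorem bp_in_zero (κ s ρ v : ℝ) (hκ : 0 < κ) (hs1 : s ≤ 1) (hρ : 0 ≤ ρ)
    (hq : (ρ - s) ^ 2 + v ^ 2 < κ ^ 2) : v < bpA κ ρ := by
  have := (bp_in_low κ s 0 ρ (-v) hκ hs1 le_rfl hρ (by linarith [neg_sq v, show (-v - 0)^2 = v^2 by ring])).2
  linarith

theorem bp_in_bump (κ γ r s h ρ v : ℝ) (hκ : 0 < κ) (hγκ : γ < κ) (hγ : 0 ≤ γ) (hr : 0 ≤ r)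
    (hr1 : r ≤ 1) (hrr : r ^ 2 = 4 * κ * γ - γ ^ 2) (hs : 0 ≤ s) (hsr : s ≤ r) (hh : 0 ≤ h)
    (hhγ : h ≤ γ) (hO : (s - r) ^ 2 + (h - 2 * κ) ^ 2 = 4 * κ ^ 2) (hρ : 0 ≤ ρ)
    (hq : (ρ - s) ^ 2 + (v - h) ^ 2 < κ ^ 2) : v < bpB κ γ r ρ := by
  have hvh : v - h < κ := by
    apply lt_of_pow_lt_pow_left₀ 2 hκ.le; nlinarith [sq_nonneg (ρ - s)]
  have hv2 : v < 2 * κ := by linarith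
  by_contra hc
  push Not at hc
  unfold bpB bpA at hc
  split_ifs at hc with h1 h2 h3
  · have hcap := bp_cap κ γ r ρ hγκ hγ hrr (by gcongr)
    have hconv : (2 * κ - γ) * (γ - h) ≤ s * r := by
      nlinarith [sq_nonneg (r - s - r), sq_nonneg (h - γ)]
    have e1 : (2 * κ - v) * (γ - h) ≤ (κ - γ / 2) * (γ - h) :=
      mul_le_mul_of_nonneg_right (by linarith) (by linarith)
    have e2 : r / 2 * s ≤ (r - ρ) * s := mul_le_mul_of_nonneg_right (by linarith) hs
    have e3 : ρ ^ 2 + (v - γ) ^ 2 < κ ^ 2 := by nlinarith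
    have e4 : |v - γ| < Real.sqrt (κ ^ 2 - ρ ^ 2) := by
      apply Real.lt_sqrt_of_sq_lt
      rw [sq_abs]; linarith
    linarith [(abs_lt.1 e4).2]
  · have e0 : κ ^ 2 < (ρ - r) ^ 2 + (v - 2 * κ) ^ 2 := by
      nlinarith [sq_nonneg ((ρ - s) - (r - ρ)), sq_nonneg ((v - h) - (2 * κ - v))]
    have e1 : Real.sqrt (κ ^ 2 - (ρ - r) ^ 2) < 2 * κ - v := by
      rw [Real.sqrt_lt' (by linarith)]; nlinarith
    linarith
  · have e0 : κ ^ 2 < (v - 2 * κ) ^ 2 := by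
      have : 4 * κ ^ 2 ≤ (s - ρ) ^ 2 + (h - 2 * κ) ^ 2 := by nlinarith
      nlinarith [sq_nonneg ((v - h) - (2 * κ - v))]
    nlinarith
  · push Not at h3
    have e0 : (ρ - r) ^ 2 + v ^ 2 < κ ^ 2 := by
      have : 0 ≤ (ρ - r) * (r - s) := mul_nonneg (by linarith) (by linarith)
      have : 0 ≤ (2 * κ - v) * h := mul_nonneg (by linarith) hh
      nlinarith
    have := bp_in_zero κ r ρ v hκ hr1 hρ e0
    rw [bpA, if_neg (by linarith)] at this
    linarith

theorem bp_filled (κ γ r ρ v : ℝ) (hκ : 0 < κ) (hγκ : γ < κ) (hγ : 0 ≤ γ) (hr : 0 ≤ r)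
    (hr1 : r ≤ 1) (hrr : r ^ 2 = 4 * κ * γ - γ ^ 2) (hρ : 0 ≤ ρ) (hρ1 : ρ ≤ 1 + κ)
    (hv1 : -bpA κ ρ ≤ v) (hv2 : v ≤ bpB κ γ r ρ) :
    (∃ s, s ≤ 1 ∧ (ρ - s) ^ 2 + v ^ 2 ≤ κ ^ 2) ∨
    (0 < v ∧ κ < v ∧ ρ ^ 2 + (v - γ) ^ 2 ≤ κ ^ 2) ∨
    (κ < v ∧ r / 2 ≤ ρ ∧ ρ ≤ r ∧ v ≤ κ + γ / 2 ∧ κ ^ 2 ≤ (ρ - r) ^ 2 + (v - 2 * κ) ^ 2) := by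
  by_cases h1 : ρ ≤ 1
  · rw [bpA, if_pos h1] at hv1
    by_cases hvκ : v ≤ κ
    · left
      refine ⟨ρ, h1, ?_⟩
      nlinarith
    · push Not at hvκ
      right
      unfold bpB bpA at hv2
      split_ifs at hv2 with h2 h3
      · left
        refine ⟨by linarith, hvκ, ?_⟩
        have : (v - γ) ^ 2 ≤ κ ^ 2 - ρ ^ 2 := by
          rw [← Real.le_sqrt (by linarith) ]
          · linarith
          · nlinarith
        linarith
      · right
        have e1 := bp_cap κ γ r (ρ - r) hγκ hγ hrr (by nlinarith)
        push Not at h2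
        refine ⟨hvκ, h2.le, h3, by linarith, ?_⟩
        have e2 : Real.sqrt (κ ^ 2 - (ρ - r) ^ 2) ≤ 2 * κ - v := by linarith
        have e3 := (Real.sqrt_le_left (by linarith)).1 e2
        nlinarith
      · linarith
  · left
    refine ⟨1, le_rfl, ?_⟩
    push Not at h1
    rw [bpA, if_neg (by linarith)] at hv1
    rw [bpB, if_neg (by linarith), if_neg (by linarith), bpA, if_neg (by linarith)] at hv2
    have e1 : |v| ≤ Real.sqrt (κ ^ 2 - (ρ - 1) ^ 2) := abs_le.2 ⟨hv1, hv2⟩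
    have e2 := (Real.le_sqrt (abs_nonneg v) (by nlinarith)).1 e1
    rw [sq_abs] at e2
    linarith

theorem bp_tri (κ a b c d : ℝ) (h1 : a ^ 2 + b ^ 2 ≤ κ ^ 2)
    (h2 : 4 * κ ^ 2 ≤ (a + c) ^ 2 + (b + d) ^ 2) : κ ^ 2 ≤ c ^ 2 + d ^ 2 := by
  nlinarith [sq_nonneg (a - c), sq_nonneg (b - d)]

theorem bp_out (κ γ r ρ v σ w : ℝ) (hκ : 0 < κ) (hγκ : γ < κ) (hγ : 0 ≤ γ) (hr : 0 ≤ r)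
    (hr1 : r ≤ 1) (hrr : r ^ 2 = 4 * κ * γ - γ ^ 2) (hρ : 0 ≤ ρ) (hρ1 : ρ ≤ 1 + κ)
    (hv1 : -bpA κ ρ ≤ v) (hv2 : v ≤ bpB κ γ r ρ)
    (hO : (0 ≤ σ ∧ σ ≤ r ∧ 2 * κ ≤ w ∧ σ ^ 2 + (w - γ) ^ 2 = 4 * κ ^ 2) ∨
      (r ≤ σ ∧ w = 2 * κ) ∨ (1 ≤ σ ∧ (σ - 1) ^ 2 + w ^ 2 = 4 * κ ^ 2) ∨ w = -(2 * κ)) :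
    κ ^ 2 ≤ (ρ - σ) ^ 2 + (v - w) ^ 2 := by
  rcases bp_filled κ γ r ρ v hκ hγκ hγ hr hr1 hrr hρ hρ1 hv1 hv2 with
    ⟨s, hs, hq⟩ | ⟨hv0, hvκ, hq⟩ | ⟨hvκ, h2, h3, h4, hq⟩
  · have : 4 * κ ^ 2 ≤ (σ - s) ^ 2 + w ^ 2 := by
      rcases hO with ⟨a1, a2, a3, a4⟩ | ⟨a1, a2⟩ | ⟨a1, a2⟩ | a1
      · nlinarith [sq_nonneg (σ - s)]
      · subst a2; nlinarith [sq_nonneg (σ - s)]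
      · nlinarith
      · subst a1; nlinarith [sq_nonneg (σ - s)]
    have := bp_tri κ (ρ - s) v (σ - ρ) (w - v) hq (by convert this using 3 <;> ring)
    linarith [sq_nonneg (ρ - σ), show (ρ - σ) ^ 2 = (σ - ρ) ^ 2 by ring,
      show (v - w) ^ 2 = (w - v) ^ 2 by ring]
  · by_cases hw : w ≤ 0
    · nlinarith [sq_nonneg (ρ - σ)]
    push Not at hw
    have : 4 * κ ^ 2 ≤ σ ^ 2 + (w - γ) ^ 2 := by
      rcases hO with ⟨a1, a2, a3, a4⟩ | ⟨a1, a2⟩ | ⟨a1, a2⟩ | a1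
      · linarith
      · subst a2; nlinarith
      · have : w ≤ 2 * κ := by
          apply le_of_sq_le_sq _ (by linarith)
          nlinarith [sq_nonneg (σ - 1)]
        nlinarith
      · linarith
    have := bp_tri κ ρ (v - γ) (σ - ρ) (w - v) hq (by convert this using 3 <;> ring)
    linarith [sq_nonneg (ρ - σ), show (ρ - σ) ^ 2 = (σ - ρ) ^ 2 by ring,
      show (v - w) ^ 2 = (w - v) ^ 2 by ring]
  · by_cases hw : w ≤ 0
    · nlinarith [sq_nonneg (ρ - σ)]
    push Not at hw
    rcases hO with ⟨a1, a2, a3, a4⟩ | ⟨a1, a2⟩ | ⟨a1, a2⟩ | a1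
    · have c1 : (2 * κ - γ) * (w - 2 * κ) ≤ r * (r - σ) := by
        nlinarith [sq_nonneg (σ - r), sq_nonneg (w - 2 * κ)]
      have c2 : (v - γ) * (w - 2 * κ) ≤ (κ - γ / 2) * (w - 2 * κ) :=
        mul_le_mul_of_nonneg_right (by linarith) (by linarith)
      have c3 : r / 2 * (r - σ) ≤ ρ * (r - σ) := mul_le_mul_of_nonneg_right h2 (by linarith)
      nlinarith
    · subst a2; nlinarith
    · have : w ≤ 2 * κ := by
        apply le_of_sq_le_sq _ (by linarith)
        nlinarith [sq_nonneg (σ - 1)]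
      have c1 : 0 ≤ (1 - ρ) * (σ - 1) := mul_nonneg (by linarith) (by linarith)
      have c2 : 0 ≤ v * (2 * κ - w) := mul_nonneg (by linarith) (by linarith)
      have c3 : (ρ - r) ^ 2 ≤ (ρ - 1) ^ 2 := by nlinarith
      nlinarith
    · linarith

theorem bp_dist {E : Type*} [NormedAddCommGroup E] [InnerProductSpace ℝ E] (p q : WithLp 2 (E × ℝ)) :
    dist p q ^ 2 = ‖p.fst - q.fst‖ ^ 2 + (p.snd - q.snd) ^ 2 := by
  rw [dist_eq_norm, WithLp.prod_norm_sq_eq_of_L2]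
  simp

theorem bp_ball {E : Type*} [NormedAddCommGroup E] [InnerProductSpace ℝ E] (p q : WithLp 2 (E × ℝ))
    (κ : ℝ) (hκ : 0 < κ) (h : q ∈ ball p κ) :
    (‖q.fst‖ - ‖p.fst‖) ^ 2 + (q.snd - p.snd) ^ 2 < κ ^ 2 := by
  rw [mem_ball] at h
  have h1 : dist q p ^ 2 < κ ^ 2 := by gcongr
  rw [bp_dist] at h1
  have h2 : (‖q.fst‖ - ‖p.fst‖) ^ 2 ≤ ‖q.fst - p.fst‖ ^ 2 := by
    rw [← sq_abs]
    gcongr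
    exact abs_norm_sub_norm_le _ _
  linarith

theorem bp_normals {E : Type*} [NormedAddCommGroup E] [InnerProductSpace ℝ E] (κ γ r : ℝ)
    (hκ : 0 < κ) (hγκ : γ < κ) (hγ : 0 ≤ γ) (hr : 0 ≤ r)
    (hr1 : r ≤ 1) (hrr : r ^ 2 = 4 * κ * γ - γ ^ 2) (u : E) (v : ℝ) (hu : ‖u‖ ≤ 1 + κ)
    (hv : v = bpB κ γ r ‖u‖ ∨ v = -bpA κ ‖u‖) :
    ∃ α h : ℝ, ((α - 1) * ‖u‖) ^ 2 + (h - v) ^ 2 = κ ^ 2 ∧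
      (∀ ρ w : ℝ, 0 ≤ ρ → (ρ - ‖α • u‖) ^ 2 + (w - h) ^ 2 < κ ^ 2 →
        ρ < 1 + κ ∧ -bpA κ ρ < w ∧ w < bpB κ γ r ρ) ∧
      (∀ ρ w : ℝ, 0 ≤ ρ → ρ ≤ 1 + κ → -bpA κ ρ ≤ w → w ≤ bpB κ γ r ρ → 
        κ ^ 2 ≤ (ρ - ‖(2 - α) • u‖) ^ 2 + (w - (2 * v - h)) ^ 2) := by
  have hu0 := norm_nonneg u
  have hA : ∀ ρ w s : ℝ, s ≤ 1 → 0 ≤ ρ → (ρ - s) ^ 2 + (w - 0) ^ 2 < κ ^ 2 →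
      ρ < 1 + κ ∧ -bpA κ ρ < w ∧ w < bpB κ γ r ρ := by
    intro ρ w s hs hρ hq
    have h1 := bp_in_low κ s 0 ρ w hκ hs le_rfl hρ hq
    rw [sub_zero] at hq
    exact ⟨h1.1, h1.2, (bp_in_zero κ s ρ w hκ hs hρ hq).trans_le
      (bpA_le_bpB κ γ r ρ hκ hγκ hγ hr hr1 hrr hρ)⟩
  have hC : ∀ ρ w s h : ℝ, 0 ≤ s → s ≤ r → 0 ≤ h → h ≤ γ →
      (s - r) ^ 2 + (h - 2 * κ) ^ 2 = 4 * κ ^ 2 → 0 ≤ ρ → (ρ - s) ^ 2 + (w - h) ^ 2 < κ ^ 2 →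
      ρ < 1 + κ ∧ -bpA κ ρ < w ∧ w < bpB κ γ r ρ := by
    intro ρ w s h hs hsr hh hhγ hO hρ hq
    have h1 := bp_in_low κ s h ρ w hκ (hsr.trans hr1) hh hρ hq
    exact ⟨h1.1, h1.2, bp_in_bump κ γ r s h ρ w hκ hγκ hγ hr hr1 hrr hs hsr hh hhγ hO hρ hq⟩
  -- side points
  have hside : 1 < ‖u‖ → v ^ 2 = κ ^ 2 - (‖u‖ - 1) ^ 2 → ∃ α h : ℝ,
      ((α - 1) * ‖u‖) ^ 2 + (h - v) ^ 2 = κ ^ 2 ∧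
      (∀ ρ w : ℝ, 0 ≤ ρ → (ρ - ‖α • u‖) ^ 2 + (w - h) ^ 2 < κ ^ 2 →
        ρ < 1 + κ ∧ -bpA κ ρ < w ∧ w < bpB κ γ r ρ) ∧
      (∀ ρ w : ℝ, 0 ≤ ρ → ρ ≤ 1 + κ → -bpA κ ρ ≤ w → w ≤ bpB κ γ r ρ → 
        κ ^ 2 ≤ (ρ - ‖(2 - α) • u‖) ^ 2 + (w - (2 * v - h)) ^ 2) := by
    intro h1 h2
    have hne : ‖u‖ ≠ 0 := by positivity
    have hi : ‖u‖⁻¹ ≤ 1 := inv_le_one_of_one_le₀ h1.le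
    have n1 : ‖‖u‖⁻¹ • u‖ = 1 := by
      rw [norm_smul, norm_inv, norm_norm, inv_mul_cancel₀ hne]
    have n2 : ‖(2 - ‖u‖⁻¹) • u‖ = 2 * ‖u‖ - 1 := by
      rw [norm_smul, Real.norm_of_nonneg (by linarith), sub_mul, inv_mul_cancel₀ hne]
    refine ⟨‖u‖⁻¹, 0, ?_, ?_, ?_⟩
    · rw [sub_mul, inv_mul_cancel₀ hne]; nlinarith
    · intro ρ w hρ hq
      rw [n1] at hq
      exact hA ρ w 1 le_rfl hρ hq
    · intro ρ w hρ hρ1 hw1 hw2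
      rw [n2]
      refine bp_out κ γ r ρ w _ _ hκ hγκ hγ hr hr1 hrr hρ hρ1 hw1 hw2
        (Or.inr (Or.inr (Or.inl ⟨by linarith, ?_⟩)))
      nlinarith
  -- flat points
  have hflat : ‖u‖ ≤ 1 → (r ≤ ‖u‖ ∧ v = κ ∨ v = -κ) → ∃ α h : ℝ,
      ((α - 1) * ‖u‖) ^ 2 + (h - v) ^ 2 = κ ^ 2 ∧
      (∀ ρ w : ℝ, 0 ≤ ρ → (ρ - ‖α • u‖) ^ 2 + (w - h) ^ 2 < κ ^ 2 →
        ρ < 1 + κ ∧ -bpA κ ρ < w ∧ w < bpB κ γ r ρ) ∧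
      (∀ ρ w : ℝ, 0 ≤ ρ → ρ ≤ 1 + κ → -bpA κ ρ ≤ w → w ≤ bpB κ γ r ρ → 
        κ ^ 2 ≤ (ρ - ‖(2 - α) • u‖) ^ 2 + (w - (2 * v - h)) ^ 2) := by
    intro h1 h2
    refine ⟨1, 0, ?_, ?_, ?_⟩
    · rcases h2 with ⟨-, h2⟩ | h2 <;> rw [h2] <;> ring
    · intro ρ w hρ hq
      rw [one_smul] at hq
      exact hA ρ w _ h1 hρ hq
    · intro ρ w hρ hρ1 hw1 hw2
      rw [show (2 : ℝ) - 1 = 1 by norm_num, one_smul]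
      refine bp_out κ γ r ρ w _ _ hκ hγκ hγ hr hr1 hrr hρ hρ1 hw1 hw2 (Or.inr ?_)
      rcases h2 with ⟨h3, h2⟩ | h2
      · left; exact ⟨h3, by rw [h2]; ring⟩
      · right; right; rw [h2]; ring
  have hsq : 1 < ‖u‖ → Real.sqrt (κ ^ 2 - (‖u‖ - 1) ^ 2) ^ 2 = κ ^ 2 - (‖u‖ - 1) ^ 2 := by
    intro h1
    exact Real.sq_sqrt (by nlinarith)
  rcases hv with hv | hv
  · unfold bpB bpA at hv
    split_ifs at hv with h1 h2 h3
    · -- cap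
      have hcap := bp_cap κ γ r ‖u‖ hγκ hγ hrr (by gcongr)
      have hs : Real.sqrt (κ ^ 2 - ‖u‖ ^ 2) ^ 2 = κ ^ 2 - ‖u‖ ^ 2 := by
        apply Real.sq_sqrt
        nlinarith
      set t := Real.sqrt (κ ^ 2 - ‖u‖ ^ 2)
      refine ⟨0, γ, by rw [hv]; nlinarith, ?_, ?_⟩
      · intro ρ w hρ hq
        rw [zero_smul, norm_zero] at hq
        exact hC ρ w 0 γ le_rfl hr hγ le_rfl (by nlinarith) hρ hq
      · intro ρ w hρ hρ1 hw1 hw2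
        rw [sub_zero, norm_smul, Real.norm_of_nonneg (by norm_num)]
        refine bp_out κ γ r ρ w _ _ hκ hγκ hγ hr hr1 hrr hρ hρ1 hw1 hw2 (Or.inl ?_)
        refine ⟨by linarith, by linarith, by rw [hv]; linarith, by rw [hv]; nlinarith⟩
    · -- fillet
      push Not at h1
      have hcap := bp_cap κ γ r (‖u‖ - r) hγκ hγ hrr (by nlinarith)
      have hle := bp_sqrt_le κ (‖u‖ - r) hκ
      have hs : Real.sqrt (κ ^ 2 - (‖u‖ - r) ^ 2) ^ 2 = κ ^ 2 - (‖u‖ - r) ^ 2 := by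
        apply Real.sq_sqrt
        nlinarith
      set t := Real.sqrt (κ ^ 2 - (‖u‖ - r) ^ 2)
      have hpos : 0 < ‖u‖ := by linarith
      have hne := hpos.ne'
      have hdiv : r / ‖u‖ ≤ 2 := by rw [div_le_iff₀ hpos]; linarith
      have n1 : ‖(2 - r / ‖u‖) • u‖ = 2 * ‖u‖ - r := by
        rw [norm_smul, Real.norm_of_nonneg (by linarith), sub_mul, div_mul_cancel₀ _ hne]
      have n2 : ‖(2 - (2 - r / ‖u‖)) • u‖ = r := by
        rw [sub_sub_cancel, norm_smul, Real.norm_of_nonneg (by positivity), div_mul_cancel₀ _ hne]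
      refine ⟨2 - r / ‖u‖, 2 * v - 2 * κ, ?_, ?_, ?_⟩
      · rw [sub_mul, sub_mul, div_mul_cancel₀ _ hne, hv]; nlinarith
      · intro ρ w hρ hq
        rw [n1] at hq
        exact hC ρ w _ _ (by linarith) (by linarith) (by linarith) (by linarith)
          (by rw [hv]; nlinarith) hρ hq
      · intro ρ w hρ hρ1 hw1 hw2
        rw [n2]
        exact bp_out κ γ r ρ w _ _ hκ hγκ hγ hr hr1 hrr hρ hρ1 hw1 hw2
          (Or.inr (Or.inl ⟨le_rfl, by ring⟩))
    · push Not at h2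
      exact hflat h3 (Or.inl ⟨h2.le, hv⟩)
    · push Not at h3
      exact hside h3 (by rw [hv, hsq h3])
  · unfold bpA at hv
    split_ifs at hv with h3
    · exact hflat h3 (Or.inr hv)
    · push Not at h3
      exact hside h3 (by rw [hv, neg_sq, hsq h3])

theorem bp_unique {E : Type*} [NormedAddCommGroup E] [InnerProductSpace ℝ E] (κ γ r : ℝ)
    (hκ : 0 < κ) (hγκ : γ < κ) (hγ : 0 ≤ γ) (hr : 0 ≤ r)
    (hr1 : r ≤ 1) (hrr : r ^ 2 = 4 * κ * γ - γ ^ 2) (S : Set (WithLp 2 (E × ℝ)))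
    (hS : S = {q | ‖q.fst‖ ≤ 1 + κ ∧ (q.snd = bpB κ γ r ‖q.fst‖ ∨ q.snd = -bpA κ ‖q.fst‖)}) :
    IsClosed S ∧ ∀ p y y' : WithLp 2 (E × ℝ), y ∈ S → y' ∈ S → (∀ q ∈ S, dist p y ≤ dist p q) →
      dist p y' = dist p y → dist p y < κ → y = y' := by
  have cA := bpA_cont κ hκ
  have cB := bpB_cont κ γ r hκ hγκ hγ hr hr1 hrr
  have cf : Continuous (fun q : WithLp 2 (E × ℝ) => ‖q.fst‖) := by fun_prop
  have cs : Continuous (fun q : WithLp 2 (E × ℝ) => q.snd) := by fun_prop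
  have cA' := cA.comp cf
  have cB' := cB.comp cf
  constructor
  · rw [hS]
    exact (isClosed_le cf continuous_const).inter
      ((isClosed_eq cs cB').union (isClosed_eq cs cA'.neg))
  have hAB : ∀ q : WithLp 2 (E × ℝ), -bpA κ ‖q.fst‖ ≤ bpB κ γ r ‖q.fst‖ := by
    intro q
    have := bpA_le_bpB κ γ r ‖q.fst‖ hκ hγκ hγ hr hr1 hrr (norm_nonneg _)
    have := bpA_nonneg κ ‖q.fst‖ hκ
    linarith
  intro p y y' hy hy' hmin heq hlt
  refine bump_abstract S
    {q | ‖q.fst‖ < 1 + κ ∧ -bpA κ ‖q.fst‖ < q.snd ∧ q.snd < bpB κ γ r ‖q.fst‖}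
    {q | 1 + κ < ‖q.fst‖ ∨ q.snd < -bpA κ ‖q.fst‖ ∨ bpB κ γ r ‖q.fst‖ < q.snd}
    κ hκ ?_ ?_ ?_ ?_ ?_ p y y' hy hy' hmin heq hlt
  · exact (isOpen_lt cf continuous_const).inter
      ((isOpen_lt cA'.neg cs).inter (isOpen_lt cs cB'))
  · exact (isOpen_lt continuous_const cf).union
      ((isOpen_lt cs cA'.neg).union (isOpen_lt cB' cs))
  · rintro q ⟨h1, h2, h3⟩ (h | h | h) <;> linarith
  · intro q hq
    by_contra hc
    simp only [Set.mem_ofPred_eq] at hc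
    push Not at hc
    obtain ⟨hc1, hc2, hc3, hc4⟩ := hc
    apply hq
    rw [hS]
    refine ⟨hc2, ?_⟩
    by_contra hne
    push Not at hne
    have g1 : q.snd < bpB κ γ r ‖q.fst‖ := lt_of_le_of_ne hc4 hne.1
    have g2 : -bpA κ ‖q.fst‖ < q.snd := lt_of_le_of_ne hc3 (Ne.symm hne.2)
    have g3 : ‖q.fst‖ = 1 + κ := by
      by_contra h
      linarith [hc1 (lt_of_le_of_ne hc2 h) g2]
    rw [g3, bpB, if_neg (by linarith), if_neg (by linarith), bpA, if_neg (by linarith)] at g1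
    rw [g3, bpA, if_neg (by linarith)] at g2
    have : κ ^ 2 - (1 + κ - 1) ^ 2 = 0 := by ring
    rw [this, Real.sqrt_zero] at g1 g2
    linarith
  · intro y hy
    rw [hS] at hy
    obtain ⟨hu, hv⟩ := hy
    obtain ⟨α, h, e1, e2, e3⟩ := bp_normals κ γ r hκ hγκ hγ hr hr1 hrr y.fst y.snd hu hv
    refine ⟨WithLp.toLp 2 (α • y.fst, h) - y, ?_, ?_, ?_⟩
    · rw [← dist_eq_norm]
      have : dist (WithLp.toLp 2 (α • y.fst, h)) y ^ 2 = κ ^ 2 := by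
        rw [bp_dist, ← e1]
        simp only [WithLp.toLp_fst, WithLp.toLp_snd]
        have : α • y.fst - y.fst = (α - 1) • y.fst := by rw [sub_smul, one_smul]
        rw [this, norm_smul, mul_pow, mul_pow, Real.norm_eq_abs, sq_abs]
      exact (pow_left_inj₀ dist_nonneg hκ.le two_ne_zero).1 this
    · intro q hq
      have := bp_ball _ q κ hκ hq
      rw [add_sub_cancel] at this
      have := e2 ‖q.fst‖ q.snd (norm_nonneg _) this
      refine ⟨this, ?_⟩
      rw [hS]
      rintro ⟨-, h | h⟩ <;> linarith
    · intro q hq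
      have h1 := bp_ball _ q κ hκ hq
      have h2 : y - (WithLp.toLp 2 (α • y.fst, h) - y) = WithLp.toLp 2 ((2 - α) • y.fst, 2 * y.snd - h) := by
        apply WithLp.ofLp_injective
        ext
        · simp [sub_smul, two_smul]; abel
        · simp; ring
      rw [h2] at h1
      have h3 := e3 ‖q.fst‖ q.snd (norm_nonneg _)
      have h4 := hAB q
      constructor
      · simp only [Set.mem_ofPred_eq]
        by_contra hc
        push Not at hc
        have := h3 hc.1 hc.2.1 hc.2.2
        simp only [WithLp.toLp_fst, WithLp.toLp_snd] at h1
        linarith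
      · rw [hS]
        rintro ⟨g1, g2⟩
        have := h3 g1 (by rcases g2 with g | g <;> linarith) (by rcases g2 with g | g <;> linarith)
        simp only [WithLp.toLp_fst, WithLp.toLp_snd] at h1
        linarith

theorem bp_proj (d D : ℕ) (hdD : d < D) (x : EuclideanSpace ℝ (Fin D)) :
    ∃ (p : WithLp 2 (EuclideanSpace ℝ (Fin d) × ℝ)) (c : ℝ), 0 ≤ c ∧
      ∀ q : WithLp 2 (EuclideanSpace ℝ (Fin d) × ℝ),
        dist x (bumpPt d D q.fst q.snd) ^ 2 = dist p q ^ 2 + c := by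
  obtain ⟨k, rfl⟩ : ∃ k, D = d + 1 + k := ⟨D - (d + 1), by omega⟩
  refine ⟨WithLp.toLp 2 (WithLp.toLp 2 (fun i => x (Fin.castAdd k (Fin.castSucc i))),
    x (Fin.castAdd k (Fin.last d))), ∑ i : Fin k, x (Fin.natAdd (d + 1) i) ^ 2, by positivity, ?_⟩
  intro q
  rw [bp_dist, EuclideanSpace.dist_sq_eq, Fin.sum_univ_add, Fin.sum_univ_castSucc,
    EuclideanSpace.norm_sq_eq]
  have h : ∀ i : Fin k, ¬ (d + 1 + (i : ℕ) < d) := fun i => by omega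
  have h' : ∀ i : Fin k, ¬ (d + 1 + (i : ℕ) = d) := fun i => by omega
  simp [bumpPt, Real.dist_eq, h, h']

theorem bp_main (d D : ℕ) (hdD : d < D) (κ γ r : ℝ)
    (hκ : 0 < κ) (hγκ : γ < κ) (hγ : 0 ≤ γ) (hr : 0 ≤ r)
    (hr1 : r ≤ 1) (hrr : r ^ 2 = 4 * κ * γ - γ ^ 2) (M : Set (EuclideanSpace ℝ (Fin D)))
    (hM : M = {y | ∃ u : EuclideanSpace ℝ (Fin d), ‖u‖ ≤ 1 + κ ∧
      (y = bumpPt d D u (bpB κ γ r ‖u‖) ∨ y = bumpPt d D u (-bpA κ ‖u‖))})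
    (x : EuclideanSpace ℝ (Fin D)) (hx : Metric.infDist x M < κ) :
    ∃! y, y ∈ M ∧ dist x y = Metric.infDist x M := by
  obtain ⟨p, c, hc, hp⟩ := bp_proj d D hdD x
  obtain ⟨hcl, hun⟩ := bp_unique (E := EuclideanSpace ℝ (Fin d)) κ γ r hκ hγκ hγ hr hr1 hrr _ rfl
  set S : Set (WithLp 2 (EuclideanSpace ℝ (Fin d) × ℝ)) :=
    {q | ‖q.fst‖ ≤ 1 + κ ∧ (q.snd = bpB κ γ r ‖q.fst‖ ∨ q.snd = -bpA κ ‖q.fst‖)}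
  have hMS : ∀ y, y ∈ M ↔ ∃ q ∈ S, y = bumpPt d D q.fst q.snd := by
    intro y
    rw [hM]
    constructor
    · rintro ⟨u, hu, h | h⟩
      · exact ⟨WithLp.toLp 2 (u, bpB κ γ r ‖u‖), ⟨hu, Or.inl rfl⟩, h⟩
      · exact ⟨WithLp.toLp 2 (u, -bpA κ ‖u‖), ⟨hu, Or.inr rfl⟩, h⟩
    · rintro ⟨q, ⟨hq, h | h⟩, rfl⟩
      · exact ⟨q.fst, hq, Or.inl (by rw [h])⟩
      · exact ⟨q.fst, hq, Or.inr (by rw [h])⟩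
  have hne : S.Nonempty :=
    ⟨WithLp.toLp 2 (0, bpB κ γ r ‖(0 : EuclideanSpace ℝ (Fin d))‖),
      by simp only [WithLp.toLp_fst, norm_zero]; linarith, Or.inl rfl⟩
  obtain ⟨q, hqS, hq⟩ := hcl.exists_infDist_eq_dist hne p
  have hmin : ∀ q' ∈ S, dist p q ≤ dist p q' := fun q' hq' => hq ▸ infDist_le_dist_of_mem hq'
  have hqM : bumpPt d D q.fst q.snd ∈ M := (hMS _).2 ⟨q, hqS, rfl⟩
  have hinf : dist x (bumpPt d D q.fst q.snd) = infDist x M := by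
    apply le_antisymm
    · rw [le_infDist ⟨_, hqM⟩]
      intro y hy
      obtain ⟨q', hq', rfl⟩ := (hMS y).1 hy
      apply le_of_sq_le_sq _ dist_nonneg
      rw [hp, hp]
      have := hmin q' hq'
      gcongr
    · exact infDist_le_dist_of_mem hqM
  have hlt : dist p q < κ := by
    refine lt_of_le_of_lt ?_ hx
    rw [← hinf]
    apply le_of_sq_le_sq _ dist_nonneg
    rw [hp]; linarith
  refine ⟨_, ⟨hqM, hinf⟩, ?_⟩
  rintro y ⟨hy, hyd⟩
  obtain ⟨q', hq', rfl⟩ := (hMS y).1 hy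
  have h1 : dist p q' ^ 2 = dist p q ^ 2 := by
    have h2 := hp q
    have h3 := hp q'
    rw [hinf] at h2
    rw [hyd] at h3
    linarith
  have h2 := (pow_left_inj₀ dist_nonneg dist_nonneg two_ne_zero).1 h1
  rw [hun p q q' hqS hq' hmin h2 hlt]

/-- **Reach of the bump construction (Theorem 5, part 1).**
For `1 ≤ d < D`, `κ > 0`, `0 < γ < κ` with `√(4κγ - γ²) ≤ 1`, each of the sets `M₀`, `M₁`
of the bump construction has reach at least `κ`: every point at distance `< κ` of the set
has a unique nearest point in the set. -/
theorem bump_reach_ge (d D : ℕ) (hd : 1 ≤ d) (hdD : d < D)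
    (κ γ : ℝ) (hκ : 0 < κ) (hγ : 0 < γ) (hγκ : γ < κ)
    (hr : Real.sqrt (4 * κ * γ - γ ^ 2) ≤ 1) :
    ∀ M ∈ ({bumpM₀ d D κ, bumpM₁ d D κ γ} : Set (Set (EuclideanSpace ℝ (Fin D)))),
      ∀ x : EuclideanSpace ℝ (Fin D), Metric.infDist x M < κ →
        ∃! y, y ∈ M ∧ dist x y = Metric.infDist x M := by

  intro M hM x hx
  have hpos : 0 ≤ 4 * κ * γ - γ ^ 2 := by nlinarith
  rcases hM with rfl | hM
  · refine bp_main d D hdD κ 0 0 hκ hκ le_rfl le_rfl zero_le_one (by ring) _ ?_ x hx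
    have hB : ∀ u : EuclideanSpace ℝ (Fin d), bpB κ 0 0 ‖u‖ = bumpA d κ u := by
      intro u
      have h0 := norm_nonneg u
      unfold bpB bumpA bpA
      by_cases h : ‖u‖ = 0
      · simp [h, Real.sqrt_sq hκ.le]
      · have : ¬ ‖u‖ ≤ 0 := fun h' => h (le_antisymm h' h0)
        rw [zero_div, if_neg this, if_neg this]
    simp only [hB]
    rfl
  · rw [Set.mem_singleton_iff] at hM
    subst hM
    exact bp_main d D hdD κ γ _ hκ hγκ hγ.le (Real.sqrt_nonneg _) hr (Real.sq_sqrt hpos) _ rfl x hx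
end

section
/- Fix integers 1 ≤ d < D, reals κ > 0 and 0 < σ < κ. There exist constants C > 0 and γ₀ > 0, depending only on κ, σ, d, D, such that for all 0 < γ ≤ γ₀ the following holds. Let M₀, M₁ be the sets of the bump construction, let Sᵢ = Mᵢ ⊕ σ, and let uᵢ = 𝟙_{Sᵢ} / V(Sᵢ) be the density of the uniform distribution on Sᵢ. Then ∫_{ℝ^D} |u₀(y) − u₁(y)| dy ≤ C γ^{(d+2)/2}. -/
open Metric MeasureTheory

open Metric

/-- The closed `σ`-neighborhood `M ⊕ σ = {y : infDist(y, M) ≤ σ}` of a set `M`. -/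
def tubeNbhd {E : Type*} [PseudoMetricSpace E] (M : Set E) (σ : ℝ) : Set E :=
  {y | Metric.infDist y M ≤ σ}

/-- The density `𝟙_S / V(S)` of the uniform distribution on a set `S ⊆ ℝ^D`. -/
noncomputable def unifDensity {E : Type*} [MeasureSpace E] (S : Set E) (y : E) : ℝ :=
  Set.indicator S (fun _ => 1) y / (volume S).toReal


lemma unif_l1_aux {E : Type*} [MeasureSpace E] (S T : Set E) (hS : MeasurableSet S)
    (hT : MeasurableSet T) (hS0 : 0 < (volume S).toReal) (hT0 : 0 < (volume T).toReal)
    (hSf : volume S ≠ ⊤) (hTf : volume T ≠ ⊤) :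
    ∫ y, |unifDensity S y - unifDensity T y| ≤
      2 * ((volume (S \ T)).toReal + (volume (T \ S)).toReal) / (volume S).toReal := by
  set a := (volume S).toReal with ha
  set b := (volume T).toReal with hb
  have hST : volume (S \ T) ≠ ⊤ := ne_top_of_le_ne_top hSf (measure_mono Set.sdiff_subset)
  have hTS : volume (T \ S) ≠ ⊤ := ne_top_of_le_ne_top hTf (measure_mono Set.sdiff_subset)
  set x := (volume (S \ T)).toReal with hx
  set z := (volume (T \ S)).toReal with hz
  have hI : ∀ U : Set E, MeasurableSet U → volume U ≠ ⊤ →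
      Integrable (U.indicator (fun _ => (1:ℝ))) volume := fun U hU hUf =>
    (integrable_indicator_iff hU).2 (integrableOn_const hUf)
  have hIv : ∀ U : Set E, MeasurableSet U →
      ∫ y, U.indicator (fun _ => (1:ℝ)) y = (volume U).toReal := fun U hU => by
    rw [integral_indicator hU]; simp [Measure.real]
  have hab : |1 / a - 1 / b| * b ≤ (x + z) / a := by
    have h1 : a ≤ b + x := by
      have : volume S ≤ volume T + volume (S \ T) := by
        refine (measure_mono ?_).trans (measure_union_le _ _)
        intro w hw; by_cases h : w ∈ T <;> simp [h, hw]
      have := ENNReal.toReal_mono (by simp [hTf, hST]) this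
      rwa [ENNReal.toReal_add hTf hST] at this
    have h2 : b ≤ a + z := by
      have : volume T ≤ volume S + volume (T \ S) := by
        refine (measure_mono ?_).trans (measure_union_le _ _)
        intro w hw; by_cases h : w ∈ S <;> simp [h, hw]
      have := ENNReal.toReal_mono (by simp [hSf, hTS]) this
      rwa [ENNReal.toReal_add hSf hTS] at this
    have hx0 : 0 ≤ x := ENNReal.toReal_nonneg
    have hz0 : 0 ≤ z := ENNReal.toReal_nonneg
    have : |1 / a - 1 / b| * b = |b - a| / a := by
      rw [div_sub_div _ _ hS0.ne' hT0.ne', abs_div, abs_of_pos (mul_pos hS0 hT0)]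
      field_simp
    rw [this]
    gcongr
    rw [abs_le]; constructor <;> linarith
  have key : ∀ y, |unifDensity S y - unifDensity T y| ≤
      (1 / a) * ((S \ T).indicator (fun _ => (1:ℝ)) y + (T \ S).indicator (fun _ => (1:ℝ)) y)
        + |1 / a - 1 / b| * T.indicator (fun _ => (1:ℝ)) y := by
    intro y
    unfold unifDensity
    rw [← ha, ← hb]
    by_cases h1 : y ∈ S <;> by_cases h2 : y ∈ T <;> simp [h1, h2]
    · rw [abs_of_pos hS0]
    · rw [abs_of_pos hT0]
      have := abs_sub_abs_le_abs_sub b⁻¹ a⁻¹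
      rw [abs_of_pos (inv_pos.2 hT0), abs_of_pos (inv_pos.2 hS0), abs_sub_comm] at this
      linarith
  have hi1 : Integrable (fun y => (S \ T).indicator (fun _ => (1:ℝ)) y +
      (T \ S).indicator (fun _ => (1:ℝ)) y) volume :=
    (hI _ (hS.diff hT) hST).add (hI _ (hT.diff hS) hTS)
  have hi2 := hi1.const_mul (1 / a)
  have hi3 := (hI _ hT hTf).const_mul (|1 / a - 1 / b|)
  have := integral_mono_of_nonneg (Filter.Eventually.of_forall fun y => abs_nonneg _)
    (hi2.add hi3) (Filter.Eventually.of_forall key)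
  refine this.trans ?_
  simp only [Pi.add_apply]
  rw [integral_add hi2 hi3, integral_const_mul, integral_const_mul,
    hIv _ hT, integral_add (hI _ (hS.diff hT) hST) (hI _ (hT.diff hS) hTS), hIv _ (hS.diff hT),
    hIv _ (hT.diff hS)]
  rw [← hx, ← hz, ← hb]
  have : 2 * (x + z) / a = 1 / a * (x + z) + (x + z) / a := by ring
  linarith

def bumpQ (d m : ℕ) (w : Fin (d + m) → ℝ) : ℝ := ∑ j : Fin m, w (Fin.natAdd d j) ^ 2

def bumpPi (d m : ℕ) (y : EuclideanSpace ℝ (Fin (d + (m + 1)))) : EuclideanSpace ℝ (Fin d) :=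
  WithLp.toLp 2 (fun i => y (Fin.castAdd (m + 1) i))

def bumpMid (d m : ℕ) : Fin (d + m + 1) := ⟨d, by omega⟩

lemma bump_dist (d m : ℕ) (y : EuclideanSpace ℝ (Fin (d + (m + 1))))
    (u : EuclideanSpace ℝ (Fin d)) (t : ℝ) :
    dist y (bumpPt d (d + (m + 1)) u t) ^ 2 =
      ‖bumpPi d m y - u‖ ^ 2 + (y (bumpMid d m) - t) ^ 2 +
        bumpQ d m ((bumpMid d m).removeNth (α := fun _ => ℝ) y) := by
  rw [EuclideanSpace.dist_eq, Real.sq_sqrt (by positivity), EuclideanSpace.norm_eq,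
    Real.sq_sqrt (by positivity), Fin.sum_univ_add, Fin.sum_univ_succ, add_assoc]
  congr 1
  · simp [bumpPt, bumpPi, Real.dist_eq]
  congr 1
  · simp [bumpPt, Real.dist_eq, bumpMid]
    rfl
  · unfold bumpQ
    refine Finset.sum_congr rfl fun j _ => ?_
    have : (bumpMid d m).succAbove (Fin.natAdd d j) = Fin.natAdd d j.succ := by
      rw [Fin.succAbove_of_le_castSucc]
      · ext; simp; omega
      · simp [bumpMid, Fin.le_def]
    simp [bumpPt, Real.dist_eq, Fin.removeNth]
    rw [this]

lemma bumpPt_cont (d D : ℕ) (f : EuclideanSpace ℝ (Fin d) → ℝ) (hf : Continuous f) :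
    Continuous fun u => bumpPt d D u (f u) := by
  unfold bumpPt
  refine (PiLp.continuous_toLp 2 (fun _ : Fin D => ℝ)).comp ?_
  refine continuous_pi fun i => ?_
  split_ifs <;> fun_prop

lemma bumpA_cont (d : ℕ) (κ : ℝ) (hκ : 0 < κ) : Continuous (bumpA d κ) := by
  unfold bumpA
  refine Continuous.if_le continuous_const (by fun_prop) (by fun_prop) (by fun_prop) ?_
  intro x hx
  simp [hx, hκ.le]

lemma bumpB_cont (d : ℕ) (κ γ : ℝ) (hκ : 0 < κ) (hγ : 0 < γ) (hγκ : γ ≤ κ)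
    (hr : Real.sqrt (4 * κ * γ - γ ^ 2) ≤ 1) : Continuous (bumpB d κ γ) := by
  have hr2 : Real.sqrt (4 * κ * γ - γ ^ 2) ^ 2 = 4 * κ * γ - γ ^ 2 := Real.sq_sqrt (by nlinarith)
  have hr0 := Real.sqrt_nonneg (4 * κ * γ - γ ^ 2)
  have hrp : 0 < Real.sqrt (4 * κ * γ - γ ^ 2) := Real.sqrt_pos.2 (by nlinarith)
  unfold bumpB
  set r := Real.sqrt (4 * κ * γ - γ ^ 2)
  refine Continuous.if_le (by fun_prop) (Continuous.if_le (by fun_prop)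
    (bumpA_cont d κ hκ) (by fun_prop) (by fun_prop) ?_) (by fun_prop) (by fun_prop) ?_
  · intro x hx
    simp [hx, bumpA, hr, hκ.le]; ring
  · intro x hx
    rw [hx, if_pos (by linarith)]
    have h : κ ^ 2 - (r / 2) ^ 2 = (κ - γ / 2) ^ 2 := by nlinarith
    have h' : κ ^ 2 - (r / 2 - r) ^ 2 = (κ - γ / 2) ^ 2 := by nlinarith
    rw [h, h', Real.sqrt_sq (by linarith)]; ring

lemma bumpB_bound (d : ℕ) (κ γ : ℝ) (hκ : 0 < κ) (hγ : 0 < γ) (hγκ : γ ≤ κ)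
    (u : EuclideanSpace ℝ (Fin d)) (hu : ‖u‖ ≤ Real.sqrt (4 * κ * γ - γ ^ 2)) :
    κ ≤ bumpB d κ γ u ∧ bumpB d κ γ u ≤ κ + γ := by
  have hr2 : Real.sqrt (4 * κ * γ - γ ^ 2) ^ 2 = 4 * κ * γ - γ ^ 2 := Real.sq_sqrt (by nlinarith)
  have hr0 := Real.sqrt_nonneg (4 * κ * γ - γ ^ 2)
  unfold bumpB
  set r := Real.sqrt (4 * κ * γ - γ ^ 2)
  have hu0 := norm_nonneg u
  have hle : ∀ x : ℝ, Real.sqrt (κ ^ 2 - x ^ 2) ≤ κ := fun x =>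
    Real.sqrt_le_iff.2 ⟨hκ.le, by nlinarith [sq_nonneg x]⟩
  split_ifs with h1
  · refine ⟨?_, by linarith [hle ‖u‖]⟩
    have : κ - γ ≤ Real.sqrt (κ ^ 2 - ‖u‖ ^ 2) := Real.le_sqrt_of_sq_le (by nlinarith)
    linarith
  · refine ⟨by linarith [hle (‖u‖ - r)], ?_⟩
    have : κ - γ ≤ Real.sqrt (κ ^ 2 - (‖u‖ - r) ^ 2) := by
      apply Real.le_sqrt_of_sq_le
      push Not at h1
      have : (‖u‖ - r) ^ 2 ≤ (r / 2) ^ 2 := by nlinarith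
      nlinarith
    linarith

lemma bumpM₀_compact (d D : ℕ) (κ : ℝ) (hκ : 0 < κ) : IsCompact (bumpM₀ d D κ) := by
  have h1 := (isCompact_closedBall (0 : EuclideanSpace ℝ (Fin d)) (1 + κ)).image
    (bumpPt_cont d D _ (bumpA_cont d κ hκ))
  have h2 := (isCompact_closedBall (0 : EuclideanSpace ℝ (Fin d)) (1 + κ)).image
    (bumpPt_cont d D _ (bumpA_cont d κ hκ).neg)
  convert h1.union h2 using 1
  ext y
  simp only [bumpM₀, Set.mem_ofPred_eq, Set.mem_union, Set.mem_image, mem_closedBall_zero_iff,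
    Pi.neg_apply]
  constructor
  · rintro ⟨u, hu, h | h⟩
    · exact Or.inl ⟨u, hu, h.symm⟩
    · exact Or.inr ⟨u, hu, h.symm⟩
  · rintro (⟨u, hu, h⟩ | ⟨u, hu, h⟩)
    · exact ⟨u, hu, Or.inl h.symm⟩
    · exact ⟨u, hu, Or.inr h.symm⟩

lemma bumpM₁_compact (d D : ℕ) (κ γ : ℝ) (hκ : 0 < κ) (hγ : 0 < γ) (hγκ : γ ≤ κ)
    (hr : Real.sqrt (4 * κ * γ - γ ^ 2) ≤ 1) : IsCompact (bumpM₁ d D κ γ) := by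
  have h1 := (isCompact_closedBall (0 : EuclideanSpace ℝ (Fin d)) (1 + κ)).image
    (bumpPt_cont d D _ (bumpB_cont d κ γ hκ hγ hγκ hr))
  have h2 := (isCompact_closedBall (0 : EuclideanSpace ℝ (Fin d)) (1 + κ)).image
    (bumpPt_cont d D _ (bumpA_cont d κ hκ).neg)
  convert h1.union h2 using 1
  ext y
  simp only [bumpM₁, Set.mem_ofPred_eq, Set.mem_union, Set.mem_image, mem_closedBall_zero_iff,
    Pi.neg_apply]
  constructor
  · rintro ⟨u, hu, h | h⟩
    · exact Or.inl ⟨u, hu, h.symm⟩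
    · exact Or.inr ⟨u, hu, h.symm⟩
  · rintro (⟨u, hu, h⟩ | ⟨u, hu, h⟩)
    · exact ⟨u, hu, Or.inl h.symm⟩
    · exact ⟨u, hu, Or.inr h.symm⟩

/-- Exclusion of a tube gives a lower bound on squared distances. -/
lemma not_tube_lt {E : Type*} [PseudoMetricSpace E] {M : Set E} {σ : ℝ} (hσ : 0 < σ) {y p : E}
    (hy : y ∉ tubeNbhd M σ) (hp : p ∈ M) : σ ^ 2 < dist y p ^ 2 := by
  have h1 : σ < infDist y M := by simpa [tubeNbhd] using hy
  have h2 := infDist_le_dist_of_mem (x := y) hp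
  have : σ < dist y p := by linarith
  nlinarith

lemma tube_mem {E : Type*} [PseudoMetricSpace E] {M : Set E} {σ : ℝ} {y : E}
    (hM : IsCompact M) (hne : M.Nonempty) (hy : y ∈ tubeNbhd M σ) :
    ∃ p ∈ M, dist y p ^ 2 ≤ σ ^ 2 := by
  obtain ⟨p, hp, h⟩ := hM.exists_infDist_eq_dist hne y
  refine ⟨p, hp, ?_⟩
  have : infDist y M ≤ σ := hy
  have h0 := dist_nonneg (x := y) (y := p)
  rw [h] at this
  nlinarith

lemma radial {F : Type*} [NormedAddCommGroup F] [NormedSpace ℝ F] (x : F) (r : ℝ) (hr : 0 ≤ r)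
    (hx : r < ‖x‖) : ∃ x' : F, ‖x'‖ = r ∧ ‖x - x'‖ = ‖x‖ - r := by
  have hx0 : 0 < ‖x‖ := by linarith
  refine ⟨(r / ‖x‖) • x, ?_, ?_⟩
  · rw [norm_smul, Real.norm_of_nonneg (by positivity)]; field_simp
  · have : x - (r / ‖x‖) • x = (1 - r / ‖x‖) • x := by rw [sub_smul, one_smul]
    rw [this, norm_smul, Real.norm_of_nonneg]
    · field_simp
    · rw [sub_nonneg, div_le_one hx0]; exact hx.le

lemma bumpQ_nonneg (d m : ℕ) (w) : 0 ≤ bumpQ d m w := by unfold bumpQ; positivity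

lemma bump_diff₁ (d m : ℕ) (κ σ γ : ℝ) (hκ : 0 < κ) (hσ : 0 < σ) (hγ : 0 < γ) (hγκ : γ ≤ κ)
    (hr : Real.sqrt (4 * κ * γ - γ ^ 2) ≤ 1 / 2)
    (y : EuclideanSpace ℝ (Fin (d + (m + 1))))
    (h0 : y ∈ tubeNbhd (bumpM₀ d (d + (m + 1)) κ) σ)
    (h1 : y ∉ tubeNbhd (bumpM₁ d (d + (m + 1)) κ γ) σ) :
    ∃ q, q = bumpQ d m ((bumpMid d m).removeNth (α := fun _ => ℝ) y) ∧
      ‖bumpPi d m y‖ ≤ Real.sqrt (4 * κ * γ - γ ^ 2) ∧ q ≤ σ ^ 2 ∧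
      κ - Real.sqrt (σ ^ 2 - q) ≤ y (bumpMid d m) ∧
      y (bumpMid d m) ≤ κ - Real.sqrt (σ ^ 2 - q) + γ := by
  refine ⟨_, rfl, ?_⟩
  have hq0 := bumpQ_nonneg d m ((bumpMid d m).removeNth (α := fun _ => ℝ) y)
  have hB := bumpB_bound d κ γ hκ hγ hγκ
  have hr0 := Real.sqrt_nonneg (4 * κ * γ - γ ^ 2)
  have hne : (bumpM₀ d (d + (m + 1)) κ).Nonempty := ⟨_, 0, by simp; linarith, Or.inl rfl⟩
  obtain ⟨p, ⟨u, hu, hp⟩, hyp⟩ := tube_mem (bumpM₀_compact d _ κ hκ) hne h0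
  have hn : ∀ w : EuclideanSpace ℝ (Fin d), ‖w‖ ≤ 1 + κ → σ ^ 2 <
      ‖bumpPi d m y - w‖ ^ 2 + (y (bumpMid d m) - bumpB d κ γ w) ^ 2 +
        bumpQ d m ((bumpMid d m).removeNth (α := fun _ => ℝ) y) := fun w hw => by
    rw [← bump_dist]
    exact not_tube_lt hσ h1 ⟨w, hw, Or.inl rfl⟩
  have hn2 : bumpPt d (d + (m + 1)) u (-bumpA d κ u) ≠ p := by
    rintro rfl
    have := not_tube_lt hσ h1 ⟨u, hu, Or.inr rfl⟩
    linarith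
  rcases hp with hp | hp
  swap
  · exact absurd hp.symm hn2
  rw [hp, bump_dist] at hyp
  have hur : ‖u‖ ≤ Real.sqrt (4 * κ * γ - γ ^ 2) := by
    by_contra hc
    have h2 := hn u hu
    have : bumpB d κ γ u = bumpA d κ u := by
      unfold bumpB; rw [if_neg (by linarith), if_neg hc]
    rw [this] at h2
    linarith
  have hA : bumpA d κ u = κ := by unfold bumpA; rw [if_pos (by linarith)]
  rw [hA] at hyp
  set q := bumpQ d m ((bumpMid d m).removeNth (α := fun _ => ℝ) y)
  set t := y (bumpMid d m)
  have hx : ‖bumpPi d m y‖ ≤ Real.sqrt (4 * κ * γ - γ ^ 2) := by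
    by_contra hc
    push Not at hc
    obtain ⟨x', hx1, hx2⟩ := radial _ _ hr0 hc
    have h2 := hn x' (by linarith)
    have hb : bumpB d κ γ x' = κ := by
      unfold bumpB; rw [if_neg, if_pos hx1.le, hx1]
      · simp [hκ.le]; ring
      · rw [hx1]
        have : 0 < Real.sqrt (4 * κ * γ - γ ^ 2) := Real.sqrt_pos.2 (by nlinarith)
        linarith
    rw [hb, hx2] at h2
    have := norm_sub_norm_le (bumpPi d m y) u
    have h3 : (‖bumpPi d m y‖ - Real.sqrt (4 * κ * γ - γ ^ 2)) ^ 2 ≤ ‖bumpPi d m y - u‖ ^ 2 := by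
      apply pow_le_pow_left₀ <;> linarith
    linarith
  have h2 := hn _ (by linarith : ‖bumpPi d m y‖ ≤ 1 + κ)
  obtain ⟨hb1, hb2⟩ := hB _ hx
  set b := bumpB d κ γ (bumpPi d m y)
  simp at h2
  have hyp' : (t - κ) ^ 2 ≤ σ ^ 2 - q := by nlinarith [sq_nonneg ‖bumpPi d m y - u‖]
  have hab := Real.abs_le_sqrt hyp'
  rw [abs_le] at hab
  refine ⟨hx, by nlinarith [sq_nonneg (t - κ)], by linarith, ?_⟩
  by_contra hc
  push Not at hc
  have : (t - b) ^ 2 ≤ Real.sqrt (σ ^ 2 - q) ^ 2 := by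
    apply sq_le_sq'  <;> linarith
  rw [Real.sq_sqrt (by nlinarith [sq_nonneg (t - κ)])] at this
  linarith

lemma bump_diff₂ (d m : ℕ) (κ σ γ : ℝ) (hκ : 0 < κ) (hσ : 0 < σ) (hγ : 0 < γ) (hγκ : γ ≤ κ)
    (hr : Real.sqrt (4 * κ * γ - γ ^ 2) ≤ 1 / 2) (hγσ : γ * (2 * σ + γ) ≤ 1 / 8)
    (y : EuclideanSpace ℝ (Fin (d + (m + 1))))
    (h1 : y ∈ tubeNbhd (bumpM₁ d (d + (m + 1)) κ γ) σ)
    (h0 : y ∉ tubeNbhd (bumpM₀ d (d + (m + 1)) κ) σ) :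
    ∃ q, q = bumpQ d m ((bumpMid d m).removeNth (α := fun _ => ℝ) y) ∧
      ‖bumpPi d m y‖ ≤ Real.sqrt (4 * κ * γ - γ ^ 2) + Real.sqrt (γ * (2 * σ + γ)) ∧ q ≤ σ ^ 2 ∧
      κ + Real.sqrt (σ ^ 2 - q) ≤ y (bumpMid d m) ∧
      y (bumpMid d m) ≤ κ + Real.sqrt (σ ^ 2 - q) + γ := by
  refine ⟨_, rfl, ?_⟩
  have hq0 := bumpQ_nonneg d m ((bumpMid d m).removeNth (α := fun _ => ℝ) y)
  have hB := bumpB_bound d κ γ hκ hγ hγκ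
  have hr0 := Real.sqrt_nonneg (4 * κ * γ - γ ^ 2)
  have hne : (bumpM₁ d (d + (m + 1)) κ γ).Nonempty := ⟨_, 0, by simp; linarith, Or.inl rfl⟩
  obtain ⟨p, ⟨u, hu, hp⟩, hyp⟩ :=
    tube_mem (bumpM₁_compact d _ κ γ hκ hγ hγκ (by linarith)) hne h1
  have hn : ∀ w : EuclideanSpace ℝ (Fin d), ‖w‖ ≤ 1 + κ → σ ^ 2 <
      ‖bumpPi d m y - w‖ ^ 2 + (y (bumpMid d m) - bumpA d κ w) ^ 2 +
        bumpQ d m ((bumpMid d m).removeNth (α := fun _ => ℝ) y) := fun w hw => by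
    rw [← bump_dist]
    exact not_tube_lt hσ h0 ⟨w, hw, Or.inl rfl⟩
  have hn2 : bumpPt d (d + (m + 1)) u (-bumpA d κ u) ≠ p := by
    rintro rfl
    have := not_tube_lt hσ h0 ⟨u, hu, Or.inr rfl⟩
    linarith
  rcases hp with hp | hp
  swap
  · exact absurd hp.symm hn2
  rw [hp, bump_dist] at hyp
  have hur : ‖u‖ ≤ Real.sqrt (4 * κ * γ - γ ^ 2) := by
    by_contra hc
    have h2 := hn u hu
    have : bumpB d κ γ u = bumpA d κ u := by
      unfold bumpB; rw [if_neg (by linarith), if_neg hc]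
    rw [this] at hyp
    linarith
  have hA : ∀ w : EuclideanSpace ℝ (Fin d), ‖w‖ ≤ 1 → bumpA d κ w = κ := fun w hw => by
    unfold bumpA; rw [if_pos hw]
  obtain ⟨hb1, hb2⟩ := hB u hur
  set q := bumpQ d m ((bumpMid d m).removeNth (α := fun _ => ℝ) y)
  set t := y (bumpMid d m)
  set b := bumpB d κ γ u
  have hyp' : (t - b) ^ 2 ≤ σ ^ 2 - q := by nlinarith [sq_nonneg ‖bumpPi d m y - u‖]
  have htb : t - b ≤ σ := by
    have : |t - b| ≤ |σ| := sq_le_sq.1 (by linarith)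
    rw [abs_of_pos hσ] at this
    exact (abs_le.1 this).2
  have hgap : (t - κ) ^ 2 - (t - b) ^ 2 ≤ γ * (2 * σ + γ) := by
    have : (t - κ) ^ 2 - (t - b) ^ 2 = (b - κ) * (2 * (t - b) + (b - κ)) := by ring
    rw [this]
    calc _ ≤ (b - κ) * (2 * σ + γ) := by
          apply mul_le_mul_of_nonneg_left <;> linarith
      _ ≤ _ := by apply mul_le_mul_of_nonneg_right <;> nlinarith
  have hx1 : ‖bumpPi d m y‖ ≤ 1 := by
    by_contra hc
    push Not at hc
    obtain ⟨x', hx1, hx2⟩ := radial _ _ zero_le_one hc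
    have h2 := hn x' (by linarith)
    rw [hA _ hx1.le, hx2] at h2
    have := norm_sub_norm_le (bumpPi d m y) u
    have h3 : (‖bumpPi d m y‖ - 1 + 1 / 2) ^ 2 ≤ ‖bumpPi d m y - u‖ ^ 2 := by
      apply pow_le_pow_left₀ <;> linarith
    nlinarith
  have h2 := hn _ (by linarith : ‖bumpPi d m y‖ ≤ 1 + κ)
  rw [hA _ hx1] at h2
  simp at h2
  have hyu : ‖bumpPi d m y - u‖ ≤ Real.sqrt (γ * (2 * σ + γ)) :=
    Real.le_sqrt_of_sq_le (by linarith)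
  have := norm_sub_norm_le (bumpPi d m y) u
  have hab := Real.abs_le_sqrt hyp'
  rw [abs_le] at hab
  refine ⟨by linarith, by nlinarith [sq_nonneg (t - b)], ?_, by linarith⟩
  by_contra hc
  push Not at hc
  have : (t - κ) ^ 2 ≤ Real.sqrt (σ ^ 2 - q) ^ 2 := by
    apply sq_le_sq'  <;> linarith
  rw [Real.sq_sqrt (by nlinarith [sq_nonneg (t - b)])] at this
  linarith

lemma slab_vol (d m : ℕ) (R σ γ : ℝ) (hR : 0 ≤ R) (hσ : 0 < σ) (hγ : 0 < γ)
    (f : (Fin (d + m) → ℝ) → ℝ) (hf : Measurable f)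
    (A : Set (EuclideanSpace ℝ (Fin (d + (m + 1)))))
    (hA : ∀ y ∈ A, ‖bumpPi d m y‖ ≤ R ∧
      bumpQ d m ((bumpMid d m).removeNth (α := fun _ => ℝ) y) ≤ σ ^ 2 ∧
      f ((bumpMid d m).removeNth (α := fun _ => ℝ) y) ≤ y (bumpMid d m) ∧
      y (bumpMid d m) ≤ f ((bumpMid d m).removeNth (α := fun _ => ℝ) y) + γ) :
    volume A ≤ ENNReal.ofReal (γ * ((2 * R) ^ d * (2 * σ) ^ m)) := by
  set c : Fin (d + m) → ℝ := Fin.addCases (fun _ => R) (fun _ => σ) with hc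
  set B : Set (Fin (d + m) → ℝ) := Set.Icc (-c) c with hB
  set P : Set (ℝ × (Fin (d + m) → ℝ)) :=
    {x | x.2 ∈ B ∧ f x.2 ≤ x.1 ∧ x.1 ≤ f x.2 + γ} with hP
  have hPm : MeasurableSet P := by
    refine (measurable_snd measurableSet_Icc).inter ?_
    exact (measurableSet_le (hf.comp measurable_snd) measurable_fst).inter
      (measurableSet_le measurable_fst ((hf.comp measurable_snd).add_const γ))
  have hBv : volume B = ENNReal.ofReal ((2 * R) ^ d * (2 * σ) ^ m) := by
    rw [hB, Real.volume_Icc_pi, ← ENNReal.ofReal_prod_of_nonneg]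
    · congr 1
      rw [Fin.prod_univ_add]
      simp [hc]
      ring
    · intro i _
      refine Fin.addCases (fun i => ?_) (fun i => ?_) i <;> simp [hc] <;> linarith
  have hPv : volume P = ENNReal.ofReal γ * volume B := by
    rw [Measure.volume_eq_prod, Measure.prod_apply_symm hPm]
    have : ∀ w : Fin (d + m) → ℝ, volume ((fun x => (x, w)) ⁻¹' P) =
        B.indicator (fun _ => ENNReal.ofReal γ) w := by
      intro w
      by_cases hw : w ∈ B
      · have h : (fun x : ℝ => (x, w)) ⁻¹' P = Set.Icc (f w) (f w + γ) := by
          ext x; simp [hP, hw]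
        rw [h, Real.volume_Icc]; simp [hw]
      · have h : (fun x : ℝ => (x, w)) ⁻¹' P = ∅ := by
          ext x; simp [hP, hw]
        rw [h]; simp [hw]
    simp_rw [this]
    rw [lintegral_indicator_const measurableSet_Icc]
  have hmp : MeasurePreserving (fun y : EuclideanSpace ℝ (Fin (d + m + 1)) =>
      MeasurableEquiv.piFinSuccAbove (fun _ => ℝ) (bumpMid d m) (WithLp.ofLp y)) :=
    (volume_preserving_piFinSuccAbove (fun _ => ℝ) (bumpMid d m)).comp
      (PiLp.volume_preserving_ofLp (Fin (d + m + 1)))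
  have hsub : A ⊆ (fun y : EuclideanSpace ℝ (Fin (d + m + 1)) =>
      MeasurableEquiv.piFinSuccAbove (fun _ => ℝ) (bumpMid d m) (WithLp.ofLp y)) ⁻¹' P := by
    intro y hy
    obtain ⟨h1, h2, h3, h4⟩ := hA y hy
    refine ⟨?_, h3, h4⟩
    have : ∀ i, |(bumpMid d m).removeNth (α := fun _ => ℝ) y i| ≤ c i := by
      intro i
      refine Fin.addCases (fun i => ?_) (fun i => ?_) i
      · have hs : (bumpMid d m).succAbove (Fin.castAdd m i) = Fin.castAdd (m + 1) i := by
          rw [Fin.succAbove_of_castSucc_lt]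
          · ext; simp
          · simp [bumpMid, Fin.lt_def]
        have h5 := PiLp.norm_apply_le (bumpPi d m y) i
        simp only [Fin.removeNth, hs, hc, Fin.addCases_left]
        exact h5.trans h1
      · have h6 : ((bumpMid d m).removeNth (α := fun _ => ℝ) y (Fin.natAdd d i)) ^ 2 ≤ σ ^ 2 := by
          refine le_trans ?_ h2
          unfold bumpQ
          exact Finset.single_le_sum (f := fun j =>
            ((bumpMid d m).removeNth (α := fun _ => ℝ) y (Fin.natAdd d j)) ^ 2)
            (fun j _ => sq_nonneg _) (Finset.mem_univ i)
        simp only [hc, Fin.addCases_right]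
        exact abs_le_of_sq_le_sq h6 hσ.le
    exact ⟨fun i => (abs_le.1 (this i)).1, fun i => (abs_le.1 (this i)).2⟩
  calc volume A ≤ _ := measure_mono hsub
    _ = volume P := hmp.measure_preimage hPm.nullMeasurableSet
    _ = _ := by rw [hPv, hBv, ENNReal.ofReal_mul hγ.le]

lemma tube_facts (D : ℕ) (M : Set (EuclideanSpace ℝ (Fin D))) (hM : IsCompact M)
    (hne : M.Nonempty) (σ : ℝ) (hσ : 0 < σ) :
    MeasurableSet (tubeNbhd M σ) ∧ volume (tubeNbhd M σ) ≠ ⊤ ∧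
      0 < (volume (tubeNbhd M σ)).toReal := by
  have hcl : IsClosed (tubeNbhd M σ) := isClosed_le (continuous_infDist_pt M) continuous_const
  have hfin : volume (tubeNbhd M σ) ≠ ⊤ := by
    have hsub : tubeNbhd M σ ⊆ cthickening σ M := fun y hy => by
      obtain ⟨p, hp, h⟩ := hM.exists_infDist_eq_dist hne y
      refine mem_cthickening_of_dist_le y p σ M hp ?_
      rw [← h]; exact hy
    exact ne_top_of_le_ne_top (hM.cthickening.measure_lt_top.ne) (measure_mono hsub)
  refine ⟨hcl.measurableSet, hfin, ENNReal.toReal_pos ?_ hfin⟩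
  obtain ⟨p, hp⟩ := hne
  have hsub : ball p σ ⊆ tubeNbhd M σ := fun y hy =>
    (infDist_le_dist_of_mem hp).trans (mem_ball.1 hy).le
  exact ((measure_ball_pos volume p hσ).trans_le (measure_mono hsub)).ne'

lemma bumpQ_meas (d m : ℕ) : Measurable (bumpQ d m) := by
  unfold bumpQ; fun_prop

/-- **L¹ distance between the uniform tube densities (Theorem 5, part 3).**
For `1 ≤ d < D`, `κ > 0`, `0 < σ < κ` there are constants `C > 0` and `γ₀ > 0`
(depending only on `κ, σ, d, D`) such that for all `0 < γ ≤ γ₀`, the densities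
`uᵢ = 𝟙_{Mᵢ ⊕ σ}/V(Mᵢ ⊕ σ)` of the uniform distributions on the tubes of the bump
construction satisfy `∫ |u₀ - u₁| ≤ C γ^{(d+2)/2}`. -/
theorem bump_unif_l1_dist (d D : ℕ) (hd : 1 ≤ d) (hdD : d < D)
    (κ σ : ℝ) (hκ : 0 < κ) (hσ : 0 < σ) (hσκ : σ < κ) :
    ∃ C > (0 : ℝ), ∃ γ₀ > (0 : ℝ), ∀ γ : ℝ, 0 < γ → γ ≤ γ₀ →
      ∫ y, |unifDensity (tubeNbhd (bumpM₀ d D κ) σ) y -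
            unifDensity (tubeNbhd (bumpM₁ d D κ γ) σ) y| ≤
        C * γ ^ (((d : ℝ) + 2) / 2) := by
  obtain ⟨m, rfl⟩ : ∃ m, D = d + (m + 1) := ⟨D - d - 1, by omega⟩
  have hM0 := bumpM₀_compact d (d + (m + 1)) κ hκ
  have hne0 : (bumpM₀ d (d + (m + 1)) κ).Nonempty :=
    ⟨_, 0, by simp; linarith, Or.inl rfl⟩
  obtain ⟨hm0, hf0, hp0⟩ := tube_facts _ _ hM0 hne0 σ hσ
  set S := tubeNbhd (bumpM₀ d (d + (m + 1)) κ) σ with hS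
  set V := (volume S).toReal with hV
  set a := Real.sqrt (4 * κ) + Real.sqrt (2 * σ + 1) with ha
  have ha0 : 0 < a := by positivity
  refine ⟨4 * ((2 * a) ^ d * (2 * σ) ^ m) / V, by positivity,
    min (min κ (1 / (16 * κ))) (min 1 (1 / (8 * (2 * σ + 1)))), by positivity, ?_⟩
  intro γ hγ hγ0
  simp only [le_min_iff] at hγ0
  obtain ⟨⟨hγκ, hγ1⟩, hγ2, hγ3⟩ := hγ0
  rw [le_div_iff₀ (by positivity)] at hγ1 hγ3
  have hr : Real.sqrt (4 * κ * γ - γ ^ 2) ≤ 1 / 2 :=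
    Real.sqrt_le_iff.2 ⟨by norm_num, by nlinarith [sq_nonneg γ]⟩
  have hγσ : γ * (2 * σ + γ) ≤ 1 / 8 := by nlinarith
  have hM1 := bumpM₁_compact d (d + (m + 1)) κ γ hκ hγ hγκ (by linarith)
  have hne1 : (bumpM₁ d (d + (m + 1)) κ γ).Nonempty :=
    ⟨_, 0, by simp; linarith, Or.inl rfl⟩
  obtain ⟨hm1, hf1, hp1⟩ := tube_facts _ _ hM1 hne1 σ hσ
  set T := tubeNbhd (bumpM₁ d (d + (m + 1)) κ γ) σ with hT
  have hra : Real.sqrt (4 * κ * γ - γ ^ 2) ≤ Real.sqrt (4 * κ) * Real.sqrt γ := by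
    rw [← Real.sqrt_mul (by positivity)]
    exact Real.sqrt_le_sqrt (by nlinarith [sq_nonneg γ])
  have hrb : Real.sqrt (γ * (2 * σ + γ)) ≤ Real.sqrt (2 * σ + 1) * Real.sqrt γ := by
    rw [← Real.sqrt_mul (by positivity)]
    exact Real.sqrt_le_sqrt (by nlinarith)
  have hrc : 0 ≤ Real.sqrt (2 * σ + 1) * Real.sqrt γ := by positivity
  set X := γ * ((2 * (a * Real.sqrt γ)) ^ d * (2 * σ) ^ m) with hX
  have hX0 : 0 ≤ X := by positivity
  have h1 : (volume (S \ T)).toReal ≤ X := by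
    refine ENNReal.toReal_le_of_le_ofReal hX0 ?_
    refine slab_vol d m _ σ γ (by positivity) hσ hγ
      (fun w => κ - Real.sqrt (σ ^ 2 - bumpQ d m w)) ?_ _ ?_
    · have := bumpQ_meas d m
      fun_prop
    · rintro y ⟨hy0, hy1⟩
      obtain ⟨q, rfl, e1, e2, e3, e4⟩ := bump_diff₁ d m κ σ γ hκ hσ hγ hγκ hr y hy0 hy1
      exact ⟨by rw [ha, add_mul]; linarith, e2, e3, e4⟩
  have h2 : (volume (T \ S)).toReal ≤ X := by
    refine ENNReal.toReal_le_of_le_ofReal hX0 ?_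
    refine slab_vol d m _ σ γ (by positivity) hσ hγ
      (fun w => κ + Real.sqrt (σ ^ 2 - bumpQ d m w)) ?_ _ ?_
    · have := bumpQ_meas d m
      fun_prop
    · rintro y ⟨hy0, hy1⟩
      obtain ⟨q, rfl, e1, e2, e3, e4⟩ := bump_diff₂ d m κ σ γ hκ hσ hγ hγκ hr hγσ y hy0 hy1
      exact ⟨by rw [ha, add_mul]; linarith, e2, e3, e4⟩
  have hpow : X = (2 * a) ^ d * (2 * σ) ^ m * γ ^ (((d : ℝ) + 2) / 2) := by
    have e : γ ^ (((d : ℝ) + 2) / 2) = Real.sqrt γ ^ d * γ := by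
      rw [show ((d : ℝ) + 2) / 2 = (1 / 2) * d + 1 by ring, Real.rpow_add hγ, Real.rpow_one,
        Real.rpow_mul hγ.le, Real.rpow_natCast, ← Real.sqrt_eq_rpow]
    rw [e, hX, ← mul_assoc 2 a, mul_pow (2 * a)]
    ring
  refine (unif_l1_aux S T hm0 hm1 hp0 hp1 hf0 hf1).trans ?_
  calc 2 * ((volume (S \ T)).toReal + (volume (T \ S)).toReal) / V
      ≤ 2 * (X + X) / V := by gcongr
    _ = _ := by rw [hpow]; ring
end

section
/- Fix integers 1 ≤ d < D and reals κ > 0, 0 < σ < κ. There exist a constant C₁ > 0 and n₀ such that for all n ≥ n₀ the following two-point minimax lower bound holds. Set γₙ = n^{−2/(d+2)}, let M₀, M₁ ⊆ ℝ^D be the sets of the bump construction with parameter γ = γₙ, and let Qᵢ be the uniform probability measure on Mᵢ ⊕ σ (Lebesgue measure restricted to Mᵢ ⊕ σ and normalized). Then for every Borel-measurable estimator M̂ from (ℝ^D)ⁿ to the space of nonempty compact subsets of ℝ^D (equipped with the Hausdorff metric), max over i ∈ {0,1} of ∫ H(M̂(y), Mᵢ) dQᵢⁿ(y) ≥ C₁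 n^{−2/(2+d)}. -/
open Metric MeasureTheory

open Metric

/-- The uniform probability measure on a set `S`: Lebesgue measure restricted to `S`
and normalized. -/
noncomputable def unifMeasure {E : Type*} [MeasureSpace E] (S : Set E) : Measure E :=
  (volume S)⁻¹ • volume.restrict S


theorem aux_pi_mono {n : ℕ} {E : Type*} [MeasurableSpace E] (μ ν : Measure E)
    [SigmaFinite μ] [SigmaFinite ν] (h : μ ≤ ν) :
    Measure.pi (fun _ : Fin n => μ) ≤ Measure.pi (fun _ : Fin n => ν) := by
  have h1 : OuterMeasure.pi (fun _ : Fin n => μ.toOuterMeasure) ≤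
      OuterMeasure.pi (fun _ : Fin n => ν.toOuterMeasure) := by
    rw [OuterMeasure.le_pi]
    intro s hs
    refine (OuterMeasure.pi_pi_le _ _).trans ?_
    exact Finset.prod_le_prod' fun i _ => h (s i)
  refine Measure.le_iff.2 fun s hs => ?_
  simp only [Measure.pi]
  rw [toMeasure_apply _ _ hs, toMeasure_apply _ _ hs]
  exact h1 s

theorem aux_meas {n : ℕ} {E : Type*} [MetricSpace E] [MeasurableSpace E]
    (est : (Fin n → E) → TopologicalSpace.NonemptyCompacts E)
    (hest : @Measurable _ _ _ (borel _) est) (M : Set E) :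
    Measurable fun y => ENNReal.ofReal (hausdorffDist (est y : Set E) M) := by
  have hc : Continuous fun K : TopologicalSpace.NonemptyCompacts E =>
      hausdorffDist (K : Set E) M := by
    refine (LipschitzWith.of_dist_le_mul (K := 1) fun K L => ?_).continuous
    have fin : ∀ K L : TopologicalSpace.NonemptyCompacts E,
        hausdorffEDist (K : Set E) (L : Set E) ≠ ⊤ := fun K L =>
      hausdorffEDist_ne_top_of_nonempty_of_bounded K.nonempty L.nonempty
        K.isCompact.isBounded L.isCompact.isBounded
    have h1 := hausdorffDist_triangle (u := M) (fin K L)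
    have h2 := hausdorffDist_triangle (u := M) (fin L K)
    have h3 : dist K L = hausdorffDist (K : Set E) L := rfl
    rw [Real.dist_eq, abs_le, NNReal.coe_one, one_mul, h3]
    rw [hausdorffDist_comm (s := (L : Set E)) (t := (K : Set E))] at h2
    constructor <;> linarith
  let _ : MeasurableSpace (TopologicalSpace.NonemptyCompacts E) := borel _
  have : BorelSpace (TopologicalSpace.NonemptyCompacts E) := ⟨rfl⟩
  exact (hc.measurable.comp hest).ennreal_ofReal

theorem aux_lecam {D n : ℕ} (hn : 1 ≤ n)
    (M0 M1 S0 S1 : Set (EuclideanSpace ℝ (Fin D)))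
    (h0 : M0.Nonempty) (hb0 : Bornology.IsBounded M0)
    (C V γ : ℝ) (hC : 0 ≤ C) (hV : 0 < V) (hγ : 0 ≤ γ)
    (hd0 : volume (S0 \ S1) ≤ ENNReal.ofReal (C / n))
    (hd1 : volume (S1 \ S0) ≤ ENNReal.ofReal (C / n))
    (hI : ENNReal.ofReal V ≤ volume (S0 ∩ S1)) (hIf : volume (S0 ∩ S1) ≠ ⊤)
    (hH : γ ≤ hausdorffDist M0 M1)
    (est : (Fin n → EuclideanSpace ℝ (Fin D)) →
          TopologicalSpace.NonemptyCompacts (EuclideanSpace ℝ (Fin D)))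
    (hest : @Measurable _ _ _ (borel _) est) :
    ENNReal.ofReal (Real.exp (-(C / V)) / 2 * γ) ≤
      max (∫⁻ y, ENNReal.ofReal (hausdorffDist (est y : Set (EuclideanSpace ℝ (Fin D))) M0)
              ∂(Measure.pi fun _ : Fin n => unifMeasure S0))
          (∫⁻ y, ENNReal.ofReal (hausdorffDist (est y : Set (EuclideanSpace ℝ (Fin D))) M1)
              ∂(Measure.pi fun _ : Fin n => unifMeasure S1)) := by
  set I := S0 ∩ S1 with hIdef
  set W := (volume I).toReal with hW
  have hWI : volume I = ENNReal.ofReal W := (ENNReal.ofReal_toReal hIf).symm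
  have hVW : V ≤ W := by
    rw [hW]; exact (ENNReal.ofReal_le_iff_le_toReal hIf).1 hI
  have hnpos : (0 : ℝ) < n := by exact_mod_cast hn
  have hW0 : 0 < W := lt_of_lt_of_le hV hVW
  have hCn : 0 ≤ C / n := by positivity
  set c := ENNReal.ofReal (W + C / n) with hc
  have hc0 : c ≠ 0 := by
    rw [hc]; simp only [ne_eq, ENNReal.ofReal_eq_zero, not_le]; positivity
  have hct : c ≠ ⊤ := ENNReal.ofReal_ne_top
  have hbound : ∀ S : Set (EuclideanSpace ℝ (Fin D)), I ⊆ S →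
      volume (S \ I) ≤ ENNReal.ofReal (C / n) → volume S ≤ c := by
    intro S hIS hS
    calc volume S = volume (I ∪ S \ I) := by rw [Set.union_sdiff_cancel hIS]
      _ ≤ volume I + volume (S \ I) := measure_union_le _ _
      _ ≤ ENNReal.ofReal W + ENNReal.ofReal (C / n) := by rw [hWI]; gcongr
      _ = c := by rw [hc, ENNReal.ofReal_add hW0.le hCn]
  have hs0 : volume S0 ≤ c := hbound S0 Set.inter_subset_left (by
    rwa [hIdef, Set.sdiff_self_inter])
  have hs1 : volume S1 ≤ c := hbound S1 Set.inter_subset_right (by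
    rwa [hIdef, Set.inter_comm, Set.sdiff_self_inter])
  set ν : Measure (EuclideanSpace ℝ (Fin D)) := c⁻¹ • volume.restrict I with hν
  have hIpos : volume I ≠ 0 := by
    rw [hWI]; simp only [ne_eq, ENNReal.ofReal_eq_zero, not_le]; exact hW0
  have hfin : ∀ S : Set (EuclideanSpace ℝ (Fin D)), I ⊆ S → volume S ≤ c →
      IsFiniteMeasure (unifMeasure S) := by
    intro S hIS hS
    refine ⟨?_⟩
    have : volume S ≠ 0 := fun h => hIpos (measure_mono_null hIS h)
    simp only [unifMeasure, Measure.smul_apply, Measure.restrict_apply_univ, smul_eq_mul]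
    rw [ENNReal.inv_mul_cancel this (ne_top_of_le_ne_top hct hS)]
    exact ENNReal.one_lt_top
  have f0 := hfin S0 Set.inter_subset_left hs0
  have f1 := hfin S1 Set.inter_subset_right hs1
  have fν : IsFiniteMeasure ν := by
    refine ⟨?_⟩
    simp only [hν, Measure.smul_apply, Measure.restrict_apply_univ, smul_eq_mul]
    exact ENNReal.mul_lt_top (ENNReal.inv_lt_top.2 (pos_iff_ne_zero.2 hc0)) (lt_top_iff_ne_top.2 hIf)
  have hle : ∀ S : Set (EuclideanSpace ℝ (Fin D)), I ⊆ S → volume S ≤ c →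
      ν ≤ unifMeasure S := by
    intro S hIS hS
    refine Measure.le_iff.2 fun s _ => ?_
    simp only [hν, unifMeasure, Measure.smul_apply, smul_eq_mul]
    exact mul_le_mul' (ENNReal.inv_le_inv.2 hS) (Measure.restrict_mono hIS le_rfl s)
  have p0 := aux_pi_mono (n := n) _ _ (hle S0 Set.inter_subset_left hs0)
  have p1 := aux_pi_mono (n := n) _ _ (hle S1 Set.inter_subset_right hs1)
  set A := ∫⁻ y, ENNReal.ofReal (hausdorffDist (est y : Set (EuclideanSpace ℝ (Fin D))) M0)
              ∂(Measure.pi fun _ : Fin n => unifMeasure S0)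
  set B := ∫⁻ y, ENNReal.ofReal (hausdorffDist (est y : Set (EuclideanSpace ℝ (Fin D))) M1)
              ∂(Measure.pi fun _ : Fin n => unifMeasure S1)
  have hνu : ν Set.univ = ENNReal.ofReal (W / (W + C / n)) := by
    simp only [hν, Measure.smul_apply, Measure.restrict_apply_univ, smul_eq_mul]
    rw [hWI, hc, ← ENNReal.ofReal_inv_of_pos (by positivity), ← ENNReal.ofReal_mul (by positivity)]
    congr 1; field_simp
  have key : ENNReal.ofReal (Real.exp (-(C / V)) * γ) ≤ A + B := by
    calc ENNReal.ofReal (Real.exp (-(C / V)) * γ)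
        ≤ ENNReal.ofReal ((W / (W + C / n)) ^ n * γ) := by
          apply ENNReal.ofReal_le_ofReal
          refine mul_le_mul_of_nonneg_right ?_ hγ
          have e1 : (W + C / n) / W ≤ Real.exp (C / V / n) := by
            calc (W + C / n) / W = C / n / W + 1 := by field_simp; ring
              _ ≤ C / n / V + 1 := by gcongr
              _ = C / V / n + 1 := by ring
              _ ≤ _ := Real.add_one_le_exp _
          have e2 : ((W + C / n) / W) ^ n ≤ Real.exp (C / V) := by
            calc ((W + C / n) / W) ^ n ≤ Real.exp (C / V / n) ^ n := by gcongr
              _ = Real.exp (C / V) := by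
                rw [← Real.exp_nat_mul]; congr 1; field_simp
          rw [Real.exp_neg, ← inv_div (W + C / n) W, inv_pow]
          exact inv_anti₀ (by positivity) e2
      _ = ENNReal.ofReal γ * (Measure.pi fun _ : Fin n => ν) Set.univ := by
          rw [Measure.pi_univ, Finset.prod_const, hνu, Finset.card_univ, Fintype.card_fin,
            ← ENNReal.ofReal_pow (by positivity), ← ENNReal.ofReal_mul hγ, mul_comm]
      _ = ∫⁻ _, ENNReal.ofReal γ ∂(Measure.pi fun _ : Fin n => ν) := by
          rw [lintegral_const]
      _ ≤ ∫⁻ y, (ENNReal.ofReal (hausdorffDist (est y : Set (EuclideanSpace ℝ (Fin D))) M0) +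
            ENNReal.ofReal (hausdorffDist (est y : Set (EuclideanSpace ℝ (Fin D))) M1))
            ∂(Measure.pi fun _ : Fin n => ν) := by
          refine lintegral_mono fun y => ?_
          dsimp only
          rw [← ENNReal.ofReal_add hausdorffDist_nonneg hausdorffDist_nonneg]
          apply ENNReal.ofReal_le_ofReal
          refine hH.trans ?_
          rw [hausdorffDist_comm (s := (est y : Set _)) (t := M0)]
          exact hausdorffDist_triangle (hausdorffEDist_ne_top_of_nonempty_of_bounded h0
            (est y).nonempty hb0 (est y).isCompact.isBounded)
      _ = _ := lintegral_add_left (aux_meas est hest M0) _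
      _ ≤ A + B := add_le_add (lintegral_mono' p0 le_rfl) (lintegral_mono' p1 le_rfl)
  have key2 : 2 * ENNReal.ofReal (Real.exp (-(C / V)) / 2 * γ) ≤ 2 * max A B := by
    calc 2 * ENNReal.ofReal (Real.exp (-(C / V)) / 2 * γ)
        = ENNReal.ofReal (Real.exp (-(C / V)) * γ) := by
          rw [show (2 : ENNReal) = ENNReal.ofReal 2 by simp, ← ENNReal.ofReal_mul (by norm_num)]
          congr 1; ring
      _ ≤ A + B := key
      _ ≤ max A B + max A B := add_le_add (le_max_left _ _) (le_max_right _ _)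
      _ = _ := (two_mul _).symm
  exact (ENNReal.mul_le_mul_iff_right (by norm_num) (by norm_num)).1 key2

theorem aux_slice (D : ℕ) (k : Fin (D + 1)) (T : Set (EuclideanSpace ℝ (Fin (D + 1))))
    (hT : MeasurableSet T) (R : Fin (D + 1) → ℝ) (γ : ℝ)
    (hbox : ∀ y ∈ T, ∀ i, i ≠ k → |y i| ≤ R i)
    (hsl : ∀ y ∈ T, ∀ y' ∈ T, (∀ i, i ≠ k → y i = y' i) → |y k - y' k| ≤ γ) :
    volume T ≤ ENNReal.ofReal γ * ∏ j : Fin D, ENNReal.ofReal (2 * R (k.succAbove j)) := by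
  set e := MeasurableEquiv.piFinSuccAbove (fun _ : Fin (D + 1) => ℝ) k
  have he := (volume_preserving_piFinSuccAbove (fun _ : Fin (D + 1) => ℝ) k).symm
  have hL := PiLp.volume_preserving_toLp (Fin (D + 1))
  have hcomp := hL.comp he
  rw [← hcomp.measure_preimage hT.nullMeasurableSet]
  have hm := hcomp.measurable hT
  rw [Measure.volume_eq_prod, Measure.prod_apply_symm hm]
  set Box : Set (Fin D → ℝ) := Set.univ.pi fun j => Set.Icc (-R (k.succAbove j)) (R (k.succAbove j))
  have hBox : MeasurableSet Box := MeasurableSet.univ_pi fun j => measurableSet_Icc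
  have hval : ∀ (x : ℝ) (w : Fin D → ℝ), WithLp.toLp 2 (e.symm (x, w)) k = x ∧
      ∀ j, WithLp.toLp 2 (e.symm (x, w)) (k.succAbove j) = w j := by
    intro x w
    exact ⟨Fin.insertNth_apply_same (α := fun _ => ℝ) k x w,
      fun j => Fin.insertNth_apply_succAbove (α := fun _ => ℝ) k x w j⟩
  calc _ ≤ ∫⁻ w, Box.indicator (fun _ => ENNReal.ofReal γ) w := by
        refine lintegral_mono fun w => ?_
        by_cases hw : w ∈ Box
        · rw [Set.indicator_of_mem hw]
          refine (Real.volume_le_diam _).trans ?_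
          refine Metric.ediam_le fun x hx x' hx' => ?_
          rw [edist_dist, Real.dist_eq]
          apply ENNReal.ofReal_le_ofReal
          have : |WithLp.toLp 2 (e.symm (x, w)) k - WithLp.toLp 2 (e.symm (x', w)) k| ≤ γ :=
            hsl _ hx _ hx' (by
            intro i hi
            obtain ⟨j, rfl⟩ := Fin.exists_succAbove_eq hi
            exact ((hval x w).2 j).trans ((hval x' w).2 j).symm)
          rwa [(hval x w).1, (hval x' w).1] at this
        · rw [Set.indicator_of_notMem hw, nonpos_iff_eq_zero]
          convert measure_empty (μ := volume)
          refine Set.eq_empty_of_forall_notMem fun x hx => hw ?_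
          intro j _
          have : |WithLp.toLp 2 (e.symm (x, w)) (k.succAbove j)| ≤ R (k.succAbove j) :=
            hbox _ hx (k.succAbove j) (Fin.succAbove_ne k j)
          rw [(hval x w).2 j] at this
          exact abs_le.1 this
    _ = ENNReal.ofReal γ * volume Box := by
        rw [lintegral_indicator hBox, setLIntegral_const]
    _ = _ := by
        rw [volume_pi_pi]
        congr 1
        refine Finset.prod_congr rfl fun j _ => ?_
        rw [Real.volume_Icc]; congr 1; ring

theorem aux_A_le {d : ℕ} {κ : ℝ} (hκ : 0 < κ) (u : EuclideanSpace ℝ (Fin d)) :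
    0 ≤ bumpA d κ u ∧ bumpA d κ u ≤ κ := by
  unfold bumpA
  split_ifs
  · exact ⟨hκ.le, le_rfl⟩
  · refine ⟨Real.sqrt_nonneg _, ?_⟩
    rw [Real.sqrt_le_left hκ.le]
    nlinarith [sq_nonneg (‖u‖ - 1)]

theorem aux_A_one {d : ℕ} {κ : ℝ} (u : EuclideanSpace ℝ (Fin d)) (hu : ‖u‖ ≤ 1) :
    bumpA d κ u = κ := by
  unfold bumpA; rw [if_pos hu]

theorem aux_rsq {κ γ : ℝ} (hγ : 0 < γ) (hγκ : γ < κ) :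
    Real.sqrt (4 * κ * γ - γ ^ 2) ^ 2 = 4 * κ * γ - γ ^ 2 :=
  Real.sq_sqrt (by nlinarith)

theorem aux_B_out {d : ℕ} {κ γ : ℝ} (u : EuclideanSpace ℝ (Fin d))
    (hu : Real.sqrt (4 * κ * γ - γ ^ 2) < ‖u‖) : bumpB d κ γ u = bumpA d κ u := by
  have h0 := Real.sqrt_nonneg (4 * κ * γ - γ ^ 2)
  unfold bumpB
  rw [if_neg (by linarith), if_neg (by linarith)]

theorem aux_B_in {d : ℕ} {κ γ : ℝ} (hγ : 0 < γ) (hγκ : γ < κ) (u : EuclideanSpace ℝ (Fin d))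
    (hu : ‖u‖ ≤ Real.sqrt (4 * κ * γ - γ ^ 2)) :
    κ ≤ bumpB d κ γ u ∧ bumpB d κ γ u ≤ κ + γ := by
  have hr := aux_rsq hγ hγκ
  have h0 := Real.sqrt_nonneg (4 * κ * γ - γ ^ 2)
  have hn := norm_nonneg u
  unfold bumpB
  set r := Real.sqrt (4 * κ * γ - γ ^ 2)
  have hκ : 0 < κ := by linarith
  split_ifs with h1
  · constructor
    · have : κ - γ ≤ Real.sqrt (κ ^ 2 - ‖u‖ ^ 2) := by
        apply Real.le_sqrt_of_sq_le
        nlinarith [mul_pos hγ hκ]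
      linarith
    · have : Real.sqrt (κ ^ 2 - ‖u‖ ^ 2) ≤ κ := by
        rw [Real.sqrt_le_left hκ.le]; nlinarith
      linarith
  · push Not at h1
    constructor
    · have : Real.sqrt (κ ^ 2 - (‖u‖ - r) ^ 2) ≤ κ := by
        rw [Real.sqrt_le_left hκ.le]; nlinarith [sq_nonneg (‖u‖ - r)]
      linarith
    · have : κ - γ ≤ Real.sqrt (κ ^ 2 - (‖u‖ - r) ^ 2) := by
        apply Real.le_sqrt_of_sq_le
        nlinarith [mul_pos hγ hκ]
      linarith

theorem aux_A_cont {d : ℕ} {κ : ℝ} (hκ : 0 < κ) : Continuous (bumpA d κ) := by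
  unfold bumpA
  refine Continuous.if_le (by fun_prop) (by fun_prop) (by fun_prop) (by fun_prop) ?_
  intro u hu
  rw [hu]; simp [Real.sqrt_sq hκ.le]

theorem aux_B_cont {d : ℕ} {κ γ : ℝ} (hγ : 0 < γ) (hγκ : γ < κ)
    (hr1 : Real.sqrt (4 * κ * γ - γ ^ 2) ≤ 1) : Continuous (bumpB d κ γ) := by
  have hr := aux_rsq hγ hγκ
  have h0 := Real.sqrt_nonneg (4 * κ * γ - γ ^ 2)
  have hκ : 0 < κ := by linarith
  have hA : Continuous (bumpA d κ) := aux_A_cont hκ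
  unfold bumpB
  set r := Real.sqrt (4 * κ * γ - γ ^ 2)
  have hr0 : 0 < r := Real.sqrt_pos.2 (by nlinarith)
  refine Continuous.if_le (by fun_prop) (Continuous.if_le (by fun_prop) hA (by fun_prop)
    (by fun_prop) ?_) (by fun_prop) (by fun_prop) ?_
  · intro u hu
    rw [aux_A_one u (by linarith), hu]; simp [Real.sqrt_sq hκ.le]; ring
  · intro u hu
    rw [if_pos (by linarith), hu]
    have e1 : κ ^ 2 - (r / 2) ^ 2 = (κ - γ / 2) ^ 2 := by nlinarith
    have e2 : κ ^ 2 - (r / 2 - r) ^ 2 = (κ - γ / 2) ^ 2 := by nlinarith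
    rw [e1, e2, Real.sqrt_sq (by linarith)]; ring

/-- horizontal part -/
noncomputable def auxU (d D : ℕ) (h : d < D) (y : EuclideanSpace ℝ (Fin D)) :
    EuclideanSpace ℝ (Fin d) :=
  WithLp.toLp 2 (fun i => y ⟨i, i.2.trans h⟩)

/-- squared norm of the last coordinates -/
noncomputable def auxZ (d D : ℕ) (y : EuclideanSpace ℝ (Fin D)) : ℝ :=
  ∑ i : Fin D, if d < (i : ℕ) then (y i) ^ 2 else 0

theorem aux_dist (d D : ℕ) (h : d < D) (y : EuclideanSpace ℝ (Fin D))
    (u : EuclideanSpace ℝ (Fin d)) (w : ℝ) :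
    dist y (bumpPt d D u w) ^ 2 = ‖auxU d D h y - u‖ ^ 2 + (y ⟨d, h⟩ - w) ^ 2 + auxZ d D y := by
  obtain ⟨m, rfl⟩ : ∃ m, D = d + 1 + m := ⟨D - (d + 1), by omega⟩
  rw [EuclideanSpace.dist_eq, Real.sq_sqrt (by positivity), EuclideanSpace.norm_sq_eq, auxZ,
    Fin.sum_univ_add, Fin.sum_univ_castSucc, Fin.sum_univ_add (a := d + 1)]
  have h1 : ∀ i : Fin d, (Fin.castAdd m (Fin.castSucc i) : Fin (d + 1 + m)) = ⟨i, i.2.trans h⟩ :=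
    fun i => rfl
  have h2 : (Fin.castAdd m (Fin.last d) : Fin (d + 1 + m)) = ⟨d, h⟩ := rfl
  simp only [h2]
  congr 1
  · congr 1
    · refine Finset.sum_congr rfl fun i _ => ?_
      simp [bumpPt, auxU, Real.dist_eq, h1]
    · simp [bumpPt, Real.dist_eq]
  · rw [Finset.sum_eq_zero (s := Finset.univ (α := Fin (d + 1))), zero_add]
    · refine Finset.sum_congr rfl fun i _ => ?_
      have e1 : ¬ (d + 1 + (i : ℕ) < d) := by omega
      have e2 : ¬ (d + 1 + (i : ℕ) = d) := by omega
      have e3 : d < d + 1 + (i : ℕ) := by omega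
      simp [bumpPt, Real.dist_eq, e1, e2, e3]
    · intro i _
      have : ¬ (d < (i : ℕ)) := by omega
      simp [this]

theorem aux_Z_nonneg (d D : ℕ) (y : EuclideanSpace ℝ (Fin D)) : 0 ≤ auxZ d D y :=
  Finset.sum_nonneg fun i _ => by split_ifs <;> positivity

theorem aux_Z_coord (d D : ℕ) (y : EuclideanSpace ℝ (Fin D)) (i : Fin D) (hi : d < (i : ℕ)) :
    (y i) ^ 2 ≤ auxZ d D y := by
  have := Finset.single_le_sum (f := fun i : Fin D => if d < (i : ℕ) then (y i) ^ 2 else 0)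
    (fun i _ => by split_ifs <;> positivity) (Finset.mem_univ i)
  simpa [hi, auxZ] using this

theorem aux_U_coord (d D : ℕ) (h : d < D) (y : EuclideanSpace ℝ (Fin D)) (i : Fin D)
    (hi : (i : ℕ) < d) : |y i| ≤ ‖auxU d D h y‖ := by
  have := PiLp.norm_apply_le (auxU d D h y) ⟨i, hi⟩
  simpa [auxU] using this

theorem aux_pt_cont (d D : ℕ) : Continuous fun p : EuclideanSpace ℝ (Fin d) × ℝ =>
    bumpPt d D p.1 p.2 := by
  refine (PiLp.continuous_toLp 2 _).comp ?_
  refine continuous_pi fun i => ?_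
  split_ifs <;> fun_prop

theorem aux_compact (d D : ℕ) (R : ℝ) (f g : EuclideanSpace ℝ (Fin d) → ℝ) (hf : Continuous f)
    (hg : Continuous g) : IsCompact {y : EuclideanSpace ℝ (Fin D) |
      ∃ u : EuclideanSpace ℝ (Fin d), ‖u‖ ≤ R ∧
    (y = bumpPt d D u (f u) ∨ y = bumpPt d D u (g u))} := by
  have hK := isCompact_closedBall (0 : EuclideanSpace ℝ (Fin d)) R
  have h1 := hK.image (f := fun u => bumpPt d D u (f u))
    ((aux_pt_cont d D).comp (continuous_id.prodMk hf))
  have h2 := hK.image (f := fun u => bumpPt d D u (g u))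
    ((aux_pt_cont d D).comp (continuous_id.prodMk hg))
  convert h1.union h2 using 1
  ext y
  simp only [Set.mem_setOf_eq, Set.mem_union, Set.mem_image, mem_closedBall, dist_zero_right]
  constructor
  · rintro ⟨u, hu, rfl | rfl⟩
    · exact Or.inl ⟨u, hu, rfl⟩
    · exact Or.inr ⟨u, hu, rfl⟩
  · rintro (⟨u, hu, rfl⟩ | ⟨u, hu, rfl⟩)
    · exact ⟨u, hu, Or.inl rfl⟩
    · exact ⟨u, hu, Or.inr rfl⟩

theorem aux_mem_tube {E : Type*} [MetricSpace E] {M : Set E} (hM : IsCompact M)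
    (hne : M.Nonempty) {σ : ℝ} {y : E} : y ∈ tubeNbhd M σ ↔ ∃ p ∈ M, dist y p ≤ σ := by
  constructor
  · intro h
    obtain ⟨p, hp, he⟩ := hM.exists_infDist_eq_dist hne y
    exact ⟨p, hp, he ▸ h⟩
  · rintro ⟨p, hp, h⟩
    exact (infDist_le_dist_of_mem hp).trans h

theorem aux_tube_closed {E : Type*} [MetricSpace E] (M : Set E) (σ : ℝ) :
    IsClosed (tubeNbhd M σ) :=
  isClosed_le (continuous_infDist_pt M) continuous_const

theorem aux_tube_bdd {E : Type*} [MetricSpace E] {M : Set E} (hM : IsCompact M)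
    (hne : M.Nonempty) (σ : ℝ) : Bornology.IsBounded (tubeNbhd M σ) := by
  obtain ⟨x, hx⟩ := hne
  obtain ⟨R, hR⟩ := hM.isBounded.subset_closedBall x
  refine (isBounded_closedBall (x := x) (r := σ + R)).subset fun y hy => ?_
  obtain ⟨p, hp, h⟩ := (aux_mem_tube hM ⟨x, hx⟩).1 hy
  have := hR hp
  rw [mem_closedBall] at this ⊢
  linarith [dist_triangle y p x]

theorem aux_box (d m : ℕ) (h : d < d + m + 1) (T : Set (EuclideanSpace ℝ (Fin (d + m + 1))))
    (hT : MeasurableSet T) (ρ σ γ : ℝ) (hρ : 0 ≤ ρ) (hσ : 0 ≤ σ) (hγ : 0 ≤ γ)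
    (hU : ∀ y ∈ T, ‖auxU d (d + m + 1) h y‖ ≤ ρ) (hZ : ∀ y ∈ T, auxZ d (d + m + 1) y ≤ σ ^ 2)
    (hsl : ∀ y ∈ T, ∀ y' ∈ T, auxU d (d + m + 1) h y = auxU d (d + m + 1) h y' →
      auxZ d (d + m + 1) y = auxZ d (d + m + 1) y' → y ⟨d, h⟩ - y' ⟨d, h⟩ ≤ γ) :
    volume T ≤ ENNReal.ofReal (γ * ((2 * ρ) ^ d * (2 * σ) ^ m)) := by
  have key := aux_slice (d + m) ⟨d, h⟩ T hT (fun i => if (i : ℕ) < d then ρ else σ) γ ?_ ?_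
  · refine key.trans_eq ?_
    rw [ENNReal.ofReal_mul hγ, ENNReal.ofReal_mul (by positivity), Fin.prod_univ_add]
    congr 2
    · rw [ENNReal.ofReal_pow (by positivity)]
      rw [Finset.prod_congr rfl (g := fun _ => ENNReal.ofReal (2 * ρ))]
      · simp
      · intro i _
        simp [Fin.succAbove, Fin.lt_def]
    · rw [ENNReal.ofReal_pow (by positivity)]
      rw [Finset.prod_congr rfl (g := fun _ => ENNReal.ofReal (2 * σ))]
      · simp
      · intro i _
        have : ¬ (d + (i : ℕ) + 1 < d) := by omega
        simp [Fin.succAbove, Fin.lt_def, this]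
  · intro y hy i hi
    by_cases hid : (i : ℕ) < d
    · rw [if_pos hid]
      exact (aux_U_coord d _ h y i hid).trans (hU y hy)
    · rw [if_neg hid]
      have hne : (i : ℕ) ≠ d := fun e => hi (Fin.ext e)
      have h1 := (aux_Z_coord d _ y i (by omega)).trans (hZ y hy)
      exact abs_le_of_sq_le_sq h1 hσ
  · intro y hy y' hy' hyy
    have e1 : auxU d (d + m + 1) h y = auxU d (d + m + 1) h y' := by
      unfold auxU
      congr 1
      funext i
      exact hyy _ (fun e => by have := congrArg Fin.val e; have := i.2; simp at *; omega)
    have e2 : auxZ d (d + m + 1) y = auxZ d (d + m + 1) y' := by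
      unfold auxZ
      refine Finset.sum_congr rfl fun i _ => ?_
      split_ifs with hi
      · rw [hyy i (fun e => by rw [e] at hi; simp at hi)]
      · rfl
    rw [abs_le]
    have a1 := hsl y hy y' hy' e1 e2
    have a2 := hsl y' hy' y hy e1.symm e2.symm
    constructor <;> linarith

theorem aux_M0_compact (d D : ℕ) {κ : ℝ} (hκ : 0 < κ) : IsCompact (bumpM₀ d D κ) :=
  aux_compact d D _ _ _ (aux_A_cont hκ) (aux_A_cont hκ).neg

theorem aux_M1_compact (d D : ℕ) {κ γ : ℝ} (hγ : 0 < γ) (hγκ : γ < κ)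
    (hr1 : Real.sqrt (4 * κ * γ - γ ^ 2) ≤ 1) : IsCompact (bumpM₁ d D κ γ) :=
  aux_compact d D _ _ _ (aux_B_cont hγ hγκ hr1) (aux_A_cont (hγ.trans hγκ)).neg

theorem aux_bot0 (d D : ℕ) {κ : ℝ} (hκ : 0 < κ) : bumpPt d D 0 (-κ) ∈ bumpM₀ d D κ :=
  ⟨0, by simp; linarith, Or.inr (by rw [aux_A_one _ (by simp)])⟩

theorem aux_bot1 (d D : ℕ) {κ : ℝ} (γ : ℝ) (hκ : 0 < κ) :
    bumpPt d D 0 (-κ) ∈ bumpM₁ d D κ γ :=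
  ⟨0, by simp; linarith, Or.inr (by rw [aux_A_one _ (by simp)])⟩

theorem aux_G0 (d D : ℕ) (h : d < D) {κ σ γ : ℝ} (hσ : 0 < σ) (hσκ : σ < κ)
    (hγ : 0 < γ) (hγκ : γ < κ) (hr1 : Real.sqrt (4 * κ * γ - γ ^ 2) ≤ 1 / 2)
    (y : EuclideanSpace ℝ (Fin D))
    (hy : y ∈ tubeNbhd (bumpM₀ d D κ) σ \ tubeNbhd (bumpM₁ d D κ γ) σ) :
    ‖auxU d D h y‖ ≤ Real.sqrt (4 * κ * γ - γ ^ 2) ∧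
    (y ⟨d, h⟩ - κ) ^ 2 + auxZ d D y ≤ σ ^ 2 ∧
    bumpB d κ γ (auxU d D h y) ≤ κ + γ ∧
    y ⟨d, h⟩ < bumpB d κ γ (auxU d D h y) ∧
    σ ^ 2 < (y ⟨d, h⟩ - bumpB d κ γ (auxU d D h y)) ^ 2 + auxZ d D y := by
  have hκ : 0 < κ := hσ.trans hσκ
  obtain ⟨hy0, hy1⟩ := hy
  obtain ⟨p, hp, hd⟩ := (aux_mem_tube (aux_M0_compact d D hκ) ⟨_, aux_bot0 d D hκ⟩).1 hy0
  have hout : ∀ q ∈ bumpM₁ d D κ γ, σ ^ 2 < dist y q ^ 2 := by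
    intro q hq
    have : σ < dist y q := by
      by_contra hc
      exact hy1 ((aux_mem_tube (aux_M1_compact d D hγ hγκ (by linarith)) ⟨_, aux_bot1 d D γ hκ⟩).2
        ⟨q, hq, not_lt.1 hc⟩)
    gcongr
  have hd2 : dist y p ^ 2 ≤ σ ^ 2 := by gcongr
  have hpn : p ∉ bumpM₁ d D κ γ := fun hc => absurd (hout p hc) (not_lt.2 hd2)
  obtain ⟨u', hu', rfl | rfl⟩ := hp
  swap
  · exact absurd ⟨u', hu', Or.inr rfl⟩ hpn
  have hur : ‖u'‖ ≤ Real.sqrt (4 * κ * γ - γ ^ 2) := by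
    by_contra hc
    exact hpn ⟨u', hu', Or.inl (by rw [aux_B_out u' (not_le.1 hc)])⟩
  rw [aux_A_one u' (by linarith), aux_dist d D h] at hd2
  have hZ := aux_Z_nonneg d D y
  set u := auxU d D h y with hu
  set v := y ⟨d, h⟩
  have hmid : (v - κ) ^ 2 + auxZ d D y ≤ σ ^ 2 := by nlinarith [sq_nonneg ‖u - u'‖]
  have huu : ‖u - u'‖ ≤ σ := by
    refine le_of_sq_le_sq ?_ hσ.le
    nlinarith [sq_nonneg (v - κ)]
  have hun : ‖u‖ ≤ 1 + κ := by
    have := norm_add_le (u - u') u'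
    rw [sub_add_cancel] at this
    linarith
  have hb := hout (bumpPt d D u (bumpB d κ γ u)) ⟨u, hun, Or.inl rfl⟩
  rw [aux_dist d D h, ← hu, sub_self, norm_zero] at hb
  have hb' : σ ^ 2 < (v - bumpB d κ γ u) ^ 2 + auxZ d D y := by
    simpa using hb
  -- the vertical displacement must be positive
  have hur2 : ‖u‖ ≤ Real.sqrt (4 * κ * γ - γ ^ 2) := by
    by_contra hc
    have hc := not_le.1 hc
    by_cases hu1 : ‖u‖ ≤ 1
    · rw [aux_B_out u hc, aux_A_one u hu1] at hb'
      linarith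
    · have hu1 := not_le.1 hu1
      have hw1 : ‖(‖u‖⁻¹ • u)‖ = 1 := by
        rw [norm_smul, norm_inv, norm_norm, inv_mul_cancel₀ (by linarith)]
      have hw2 : ‖u - (‖u‖⁻¹ • u)‖ = ‖u‖ - 1 := by
        have : u - (‖u‖⁻¹ • u) = (1 - ‖u‖⁻¹) • u := by rw [sub_smul, one_smul]
        rw [this, norm_smul, Real.norm_of_nonneg, sub_mul, inv_mul_cancel₀ (by linarith), one_mul]
        rw [sub_nonneg]; exact inv_le_one_of_one_le₀ hu1.le
      have hq := hout _ ⟨‖u‖⁻¹ • u, by linarith, Or.inl rfl⟩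
      rw [aux_B_out _ (by rw [hw1]; linarith), aux_A_one _ hw1.le, aux_dist d D h, ← hu, hw2] at hq
      have htri : ‖u‖ ≤ ‖u - u'‖ + ‖u'‖ := by
        have := norm_add_le (u - u') u'
        rwa [sub_add_cancel] at this
      have h3 : (‖u‖ - 1) ^ 2 ≤ ‖u - u'‖ ^ 2 := by
        apply pow_le_pow_left₀ <;> linarith
      change σ ^ 2 < (‖u‖ - 1) ^ 2 + (v - κ) ^ 2 + auxZ d D y at hq
      linarith
  obtain ⟨b1, b2⟩ := aux_B_in hγ hγκ u hur2
  refine ⟨hur2, hmid, b2, ?_, hb'⟩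
  nlinarith

theorem aux_G1 (d D : ℕ) (h : d < D) {κ σ γ : ℝ} (hσ : 0 < σ) (hκ : 0 < κ)
    (hγ : 0 < γ) (hγκ : γ < κ) (hr1 : Real.sqrt (4 * κ * γ - γ ^ 2) ≤ 1 / 2)
    (hγ1 : γ ≤ 1) (hγσ : 2 * γ * (σ + 1) ≤ 1 / 4)
    (y : EuclideanSpace ℝ (Fin D))
    (hy : y ∈ tubeNbhd (bumpM₁ d D κ γ) σ \ tubeNbhd (bumpM₀ d D κ) σ) :
    ‖auxU d D h y‖ ≤ Real.sqrt (4 * κ * γ - γ ^ 2) + Real.sqrt (2 * γ * (σ + 1)) ∧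
    κ < y ⟨d, h⟩ ∧ σ ^ 2 < (y ⟨d, h⟩ - κ) ^ 2 + auxZ d D y ∧
    ∃ b, b ≤ κ + γ ∧ (y ⟨d, h⟩ - b) ^ 2 + auxZ d D y ≤ σ ^ 2 := by
  obtain ⟨hy1, hy0⟩ := hy
  obtain ⟨p, hp, hd⟩ := (aux_mem_tube (aux_M1_compact d D hγ hγκ (by linarith))
    ⟨_, aux_bot1 d D γ hκ⟩).1 hy1
  have hout : ∀ q ∈ bumpM₀ d D κ, σ ^ 2 < dist y q ^ 2 := by
    intro q hq
    have : σ < dist y q := by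
      by_contra hc
      exact hy0 ((aux_mem_tube (aux_M0_compact d D hκ) ⟨_, aux_bot0 d D hκ⟩).2
        ⟨q, hq, not_lt.1 hc⟩)
    gcongr
  have hd2 : dist y p ^ 2 ≤ σ ^ 2 := by gcongr
  have hpn : p ∉ bumpM₀ d D κ := fun hc => absurd (hout p hc) (not_lt.2 hd2)
  obtain ⟨u', hu', rfl | rfl⟩ := hp
  swap
  · exact absurd ⟨u', hu', Or.inr rfl⟩ hpn
  have hur : ‖u'‖ ≤ Real.sqrt (4 * κ * γ - γ ^ 2) := by
    by_contra hc
    exact hpn ⟨u', hu', Or.inl (by rw [aux_B_out u' (not_le.1 hc)])⟩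
  obtain ⟨b1, b2⟩ := aux_B_in hγ hγκ u' hur
  rw [aux_dist d D h] at hd2
  have hZ := aux_Z_nonneg d D y
  set u := auxU d D h y with hu
  set v := y ⟨d, h⟩
  set b := bumpB d κ γ u'
  set r := Real.sqrt (4 * κ * γ - γ ^ 2)
  have hmid : (v - b) ^ 2 + auxZ d D y ≤ σ ^ 2 := by nlinarith [sq_nonneg ‖u - u'‖]
  have hvb : v - b ≤ σ := by
    have : (v - b) ^ 2 ≤ σ ^ 2 := by linarith
    exact (abs_le.1 (abs_le_of_sq_le_sq this hσ.le)).2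
  have hdiff : (v - κ) ^ 2 - (v - b) ^ 2 ≤ 2 * γ * (σ + 1) := by
    have e : (v - κ) ^ 2 - (v - b) ^ 2 = (b - κ) * (2 * v - b - κ) := by ring
    rw [e]
    calc (b - κ) * (2 * v - b - κ) ≤ (b - κ) * (2 * σ + 2) := by
          apply mul_le_mul_of_nonneg_left <;> linarith
      _ ≤ γ * (2 * σ + 2) := by
          apply mul_le_mul_of_nonneg_right <;> linarith
      _ = _ := by ring
  have htri : ‖u‖ ≤ ‖u - u'‖ + ‖u'‖ := by
    have := norm_add_le (u - u') u'
    rwa [sub_add_cancel] at this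
  have hu1 : ‖u‖ ≤ 1 := by
    by_contra hc
    have hc := not_le.1 hc
    have hw1 : ‖(‖u‖⁻¹ • u)‖ = 1 := by
      rw [norm_smul, norm_inv, norm_norm, inv_mul_cancel₀ (by linarith)]
    have hw2 : ‖u - (‖u‖⁻¹ • u)‖ = ‖u‖ - 1 := by
      have : u - (‖u‖⁻¹ • u) = (1 - ‖u‖⁻¹) • u := by rw [sub_smul, one_smul]
      rw [this, norm_smul, Real.norm_of_nonneg, sub_mul, inv_mul_cancel₀ (by linarith), one_mul]
      rw [sub_nonneg]; exact inv_le_one_of_one_le₀ hc.le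
    have hq := hout _ ⟨‖u‖⁻¹ • u, by linarith, Or.inl rfl⟩
    rw [aux_A_one _ hw1.le, aux_dist d D h, ← hu, hw2] at hq
    have h3 : (‖u‖ - 1 / 2) ^ 2 ≤ ‖u - u'‖ ^ 2 := by
      apply pow_le_pow_left₀ <;> linarith
    change σ ^ 2 < (‖u‖ - 1) ^ 2 + (v - κ) ^ 2 + auxZ d D y at hq
    nlinarith
  have hq := hout _ ⟨u, by linarith, Or.inl rfl⟩
  rw [aux_A_one _ hu1, aux_dist d D h, ← hu, sub_self, norm_zero] at hq
  have hq' : σ ^ 2 < (v - κ) ^ 2 + auxZ d D y := by simpa using hq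
  refine ⟨?_, ?_, hq', b, b2, hmid⟩
  · have : ‖u - u'‖ ≤ Real.sqrt (2 * γ * (σ + 1)) := by
      apply Real.le_sqrt_of_sq_le
      nlinarith
    linarith
  · nlinarith

theorem aux_haus (d D : ℕ) (h : d < D) {κ γ : ℝ} (hγ : 0 < γ) (hγκ : γ < κ)
    (hr1 : Real.sqrt (4 * κ * γ - γ ^ 2) ≤ 1) :
    γ ≤ hausdorffDist (bumpM₀ d D κ) (bumpM₁ d D κ γ) := by
  have hκ : 0 < κ := hγ.trans hγκ
  by_contra hc
  have hc := not_le.1 hc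
  have hmem : bumpPt d D 0 (κ + γ) ∈ bumpM₁ d D κ γ := by
    refine ⟨0, by simp; linarith, Or.inl ?_⟩
    congr 1
    unfold bumpB
    rw [if_pos (by rw [norm_zero]; positivity)]
    simp [Real.sqrt_sq hκ.le]; ring
  obtain ⟨x, hx, hlt⟩ := exists_dist_lt_of_hausdorffDist_lt' hmem hc
    (hausdorffEDist_ne_top_of_nonempty_of_bounded ⟨_, aux_bot0 d D hκ⟩ ⟨_, hmem⟩
      (aux_M0_compact d D hκ).isBounded (aux_M1_compact d D hγ hγκ hr1).isBounded)
  have hv : x ⟨d, h⟩ ≤ κ := by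
    obtain ⟨u, hu, rfl | rfl⟩ := hx
    · simpa [bumpPt] using (aux_A_le hκ u).2
    · have := (aux_A_le hκ u).1
      simp [bumpPt]; linarith
  have h1 := aux_dist d D h x 0 (κ + γ)
  have h2 : dist x (bumpPt d D 0 (κ + γ)) ^ 2 < γ ^ 2 := by
    gcongr
  have := aux_Z_nonneg d D x
  nlinarith [sq_nonneg ‖auxU d D h x - 0‖]

set_option maxHeartbeats 1000000 in
/-- **Two-point minimax lower bound (Theorem 1).** For `1 ≤ d < D`, `κ > 0`, `0 < σ < κ`,
there exist `C₁ > 0` and `n₀` such that for all `n ≥ n₀`, with `γₙ = n^{-2/(d+2)}`,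
`M₀, M₁` the bump construction with parameter `γₙ`, and `Qᵢ` the uniform distribution
on `Mᵢ ⊕ σ`: every Borel-measurable estimator `est` taking values in the nonempty compact
subsets of `ℝ^D` (with the Hausdorff metric) satisfies
`max_i ∫ H(est y, Mᵢ) dQᵢⁿ(y) ≥ C₁ n^{-2/(2+d)}`. -/
theorem bump_two_point_minimax_lower_bound (d D : ℕ) (hd : 1 ≤ d) (hdD : d < D)
    (κ σ : ℝ) (hκ : 0 < κ) (hσ : 0 < σ) (hσκ : σ < κ) :
    ∃ C₁ > (0 : ℝ), ∃ n₀ : ℕ, ∀ n : ℕ, n₀ ≤ n →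
      ∀ est : (Fin n → EuclideanSpace ℝ (Fin D)) →
          TopologicalSpace.NonemptyCompacts (EuclideanSpace ℝ (Fin D)),
        @Measurable _ _ _ (borel _) est →
        ENNReal.ofReal (C₁ * (n : ℝ) ^ (-(2 : ℝ) / (2 + (d : ℝ)))) ≤
          max
            (∫⁻ y, ENNReal.ofReal
                (Metric.hausdorffDist (est y : Set (EuclideanSpace ℝ (Fin D)))
                  (bumpM₀ d D κ))
              ∂(Measure.pi fun _ : Fin n =>
                  unifMeasure (tubeNbhd (bumpM₀ d D κ) σ)))
            (∫⁻ y, ENNReal.ofReal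
                (Metric.hausdorffDist (est y : Set (EuclideanSpace ℝ (Fin D)))
                  (bumpM₁ d D κ ((n : ℝ) ^ (-(2 : ℝ) / ((d : ℝ) + 2)))))
              ∂(Measure.pi fun _ : Fin n =>
                  unifMeasure
                    (tubeNbhd (bumpM₁ d D κ ((n : ℝ) ^ (-(2 : ℝ) / ((d : ℝ) + 2)))) σ))) := by
  set Cρ : ℝ := 2 * Real.sqrt κ + Real.sqrt (2 * (σ + 1)) with hCρ
  obtain ⟨m, rfl⟩ : ∃ m, D = d + m + 1 := ⟨D - (d + 1), by omega⟩
  have hCρ0 : 0 ≤ Cρ := by positivity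
  set C : ℝ := (2 * Cρ) ^ d * (2 * σ) ^ m with hC
  have hC0 : 0 ≤ C := by positivity
  set Bl := volume (closedBall (bumpPt d (d + m + 1) 0 (-κ)) σ) with hBl
  set V : ℝ := Bl.toReal with hV
  have hBlt : Bl ≠ ⊤ := measure_closedBall_lt_top.ne
  have hBl0 : Bl ≠ 0 := (measure_closedBall_pos volume _ hσ).ne'
  have hV0 : 0 < V := ENNReal.toReal_pos hBl0 hBlt
  -- smallness of γ
  have htend : Filter.Tendsto (fun n : ℕ => (n : ℝ) ^ (-(2 : ℝ) / ((d : ℝ) + 2))) Filter.atTop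
      (nhds 0) := by
    have := (tendsto_rpow_neg_atTop (y := 2 / ((d : ℝ) + 2)) (by positivity)).comp
      tendsto_natCast_atTop_atTop
    refine this.congr fun n => ?_
    simp only [Function.comp]
    rw [neg_div]
  have hε : 0 < min (min 1 κ) (min (1 / (16 * κ)) (1 / (8 * (σ + 1)))) := by positivity
  obtain ⟨n₁, hn₁⟩ := Filter.eventually_atTop.1 (htend.eventually_lt_const hε)
  refine ⟨Real.exp (-(C / V)) / 2, by positivity, max n₁ 1, fun n hn est hest => ?_⟩
  have hn1 : 1 ≤ n := (le_max_right _ _).trans hn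
  have hnpos : (0 : ℝ) < n := by exact_mod_cast hn1
  have hsm := hn₁ n ((le_max_left _ _).trans hn)
  rw [add_comm (2 : ℝ) (d : ℝ)]
  have hγn : (n : ℝ) ^ (-(2 : ℝ) / ((d : ℝ) + 2)) = ((n : ℝ) ^ (-(1 : ℝ) / ((d : ℝ) + 2))) ^ 2 := by
    rw [← Real.rpow_natCast, ← Real.rpow_mul hnpos.le]
    congr 1; push_cast; ring
  set γ := (n : ℝ) ^ (-(2 : ℝ) / ((d : ℝ) + 2)) with hγdef
  set s := (n : ℝ) ^ (-(1 : ℝ) / ((d : ℝ) + 2)) with hs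
  have hs0 : 0 < s := Real.rpow_pos_of_pos hnpos _
  have hsn : s ^ (d + 2) = 1 / n := by
    rw [hs, ← Real.rpow_natCast, ← Real.rpow_mul hnpos.le, one_div, ← Real.rpow_neg_one]
    congr 1; push_cast; field_simp
  have hγ : 0 < γ := Real.rpow_pos_of_pos hnpos _
  simp only [lt_min_iff] at hsm
  obtain ⟨⟨hγ1, hγκ⟩, hγ3, hγ4⟩ := hsm
  rw [lt_div_iff₀ (by positivity)] at hγ3 hγ4
  have hr : Real.sqrt (4 * κ * γ - γ ^ 2) ≤ 1 / 2 := by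
    rw [Real.sqrt_le_left (by norm_num)]; nlinarith
  have hγσ : 2 * γ * (σ + 1) ≤ 1 / 4 := by linarith
  have hrs : Real.sqrt (4 * κ * γ - γ ^ 2) ≤ 2 * Real.sqrt κ * s := by
    rw [Real.sqrt_le_left (by positivity), mul_pow, mul_pow, Real.sq_sqrt hκ.le, ← hγn]
    nlinarith
  have hqs : Real.sqrt (2 * γ * (σ + 1)) ≤ Real.sqrt (2 * (σ + 1)) * s := by
    rw [Real.sqrt_le_left (by positivity), mul_pow, Real.sq_sqrt (by positivity), ← hγn]
    nlinarith
  have hvol : γ * ((2 * (Cρ * s)) ^ d * (2 * σ) ^ m) = C / n := by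
    rw [hγn, hC, div_eq_mul_one_div, ← hsn]; ring
  have hM0 := aux_M0_compact d (d + m + 1) hκ
  have hM1 := aux_M1_compact d (d + m + 1) hγ hγκ (by linarith)
  have hb0 := aux_bot0 d (d + m + 1) hκ
  have hb1 := aux_bot1 d (d + m + 1) γ hκ
  have hcl0 := (aux_tube_closed (bumpM₀ d (d + m + 1) κ) σ).measurableSet
  have hcl1 := (aux_tube_closed (bumpM₁ d (d + m + 1) κ γ) σ).measurableSet
  have hq0 : 0 ≤ Real.sqrt (2 * (σ + 1)) * s := by positivity
  refine aux_lecam hn1 _ _ _ _ ⟨_, hb0⟩ hM0.isBounded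
    C V γ hC0 hV0 hγ.le ?_ ?_ ?_ ?_ (aux_haus d _ hdD hγ hγκ (by linarith)) est hest
  · rw [← hvol]
    refine aux_box d m hdD _ (hcl0.diff hcl1) (Cρ * s) σ γ (by positivity) hσ.le hγ.le ?_ ?_ ?_
    · intro y hy
      have := (aux_G0 d _ hdD hσ hσκ hγ hγκ hr y hy).1
      rw [hCρ, add_mul]; linarith
    · intro y hy
      have := (aux_G0 d _ hdD hσ hσκ hγ hγκ hr y hy).2.1
      nlinarith [sq_nonneg (y ⟨d, hdD⟩ - κ)]
    · intro y hy y' hy' e1 e2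
      obtain ⟨-, -, g1, g2, g3⟩ := aux_G0 d _ hdD hσ hσκ hγ hγκ hr y hy
      obtain ⟨-, g4, -, -, -⟩ := aux_G0 d _ hdD hσ hσκ hγ hγκ hr y' hy'
      set b := bumpB d κ γ (auxU d (d + m + 1) hdD y)
      have h1 : (κ - y' ⟨d, hdD⟩) ^ 2 < (b - y ⟨d, hdD⟩) ^ 2 := by
        rw [e2] at g3; nlinarith
      have := abs_lt_of_sq_lt_sq' h1 (by linarith)
      linarith [this.2]
  · rw [← hvol]
    refine aux_box d m hdD _ (hcl1.diff hcl0) (Cρ * s) σ γ (by positivity) hσ.le hγ.le ?_ ?_ ?_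
    · intro y hy
      have := (aux_G1 d _ hdD hσ hκ hγ hγκ hr hγ1.le hγσ y hy).1
      rw [hCρ, add_mul]; linarith
    · intro y hy
      obtain ⟨-, -, -, b, -, h2⟩ := aux_G1 d _ hdD hσ hκ hγ hγκ hr hγ1.le hγσ y hy
      nlinarith [sq_nonneg (y ⟨d, hdD⟩ - b)]
    · intro y hy y' hy' e1 e2
      obtain ⟨-, -, -, b, g1, g2⟩ := aux_G1 d _ hdD hσ hκ hγ hγκ hr hγ1.le hγσ y hy
      obtain ⟨-, g3, g4, -⟩ := aux_G1 d _ hdD hσ hκ hγ hγκ hr hγ1.le hγσ y' hy'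
      have h1 : (y ⟨d, hdD⟩ - b) ^ 2 < (y' ⟨d, hdD⟩ - κ) ^ 2 := by
        rw [e2] at g2; linarith
      have := abs_lt_of_sq_lt_sq' h1 (by linarith)
      linarith [this.2]
  · rw [hV, ENNReal.ofReal_toReal hBlt]
    refine measure_mono fun y hy => ⟨?_, ?_⟩
    · exact (aux_mem_tube hM0 ⟨_, hb0⟩).2 ⟨_, hb0, hy⟩
    · exact (aux_mem_tube hM1 ⟨_, hb1⟩).2 ⟨_, hb1, hy⟩
  · exact ((aux_tube_bdd hM0 ⟨_, hb0⟩ σ).subset Set.inter_subset_left).measure_lt_top.ne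
end

section
/- Let M be a nonempty closed subset of ℝ^D and let σ > 0. Let S = M ⊕ σ = {y ∈ ℝ^D : infDist(y, M) ≤ σ}. Then for every y ∈ S and every ε with 0 < ε ≤ σ, the Lebesgue measure satisfies V(B(y, ε) ∩ S) ≥ 2^{−D} V(B(y, ε)), where B(y, ε) is the open ball of radius ε around y. -/
open Metric MeasureTheory ENNReal

/-- **The tube `S = M ⊕ σ` is `(2^{-D}, σ)`-standard (Lemma 17, first part).**
For every nonempty closed `M ⊆ ℝ^D` and `σ > 0`, every `y ∈ S = M ⊕ σ` and every
`0 < ε ≤ σ`, we have `V(B(y,ε) ∩ S) ≥ 2^{-D} V(B(y,ε))`. -/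
theorem tube_standard (D : ℕ) (M : Set (EuclideanSpace ℝ (Fin D)))
    (hM : M.Nonempty) (hMc : IsClosed M) (σ : ℝ) (hσ : 0 < σ) :
    ∀ y ∈ tubeNbhd M σ, ∀ ε : ℝ, 0 < ε → ε ≤ σ →
      ((2 : ℝ≥0∞) ^ D)⁻¹ * volume (Metric.ball y ε) ≤
        volume (Metric.ball y ε ∩ tubeNbhd M σ) := by
  intro y hy ε hε hεσ
  obtain ⟨m, hm, hd⟩ := hMc.exists_infDist_eq_dist hM y
  have hyd : dist y m ≤ σ := by
    rw [← hd]; exact hy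
  obtain ⟨t, ht⟩ : ∃ t : ℝ, t = ε / (2 * σ) := ⟨_, rfl⟩
  have htσ : t * σ = ε / 2 := by rw [ht]; field_simp
  have ht0 : 0 ≤ t := by rw [ht]; positivity
  have ht1 : t ≤ 1 := by rw [ht, div_le_one (by positivity)]; linarith
  have h1 : dist (AffineMap.lineMap y m t) y ≤ ε / 2 := by
    rw [dist_lineMap_left, Real.norm_of_nonneg ht0, ← htσ]
    exact mul_le_mul_of_nonneg_left hyd ht0
  have h2 : dist (AffineMap.lineMap y m t) m ≤ σ - ε / 2 := by
    rw [dist_lineMap_right, Real.norm_of_nonneg (sub_nonneg.2 ht1)]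
    have := mul_le_mul_of_nonneg_left hyd (sub_nonneg.2 ht1)
    linarith
  generalize (AffineMap.lineMap y m t : EuclideanSpace ℝ (Fin D)) = z at h1 h2
  have hsub : Metric.ball z (ε / 2) ⊆ Metric.ball y ε ∩ tubeNbhd M σ := by
    intro w hw
    rw [Metric.mem_ball] at hw
    refine ⟨?_, ?_⟩
    · rw [Metric.mem_ball]
      linarith [dist_triangle w z y]
    · show Metric.infDist w M ≤ σ
      linarith [Metric.infDist_le_dist_of_mem (x := w) hm, dist_triangle w z m]
  refine le_trans (le_of_eq ?_) (measure_mono hsub)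
  have e : ε / 2 = 2⁻¹ * ε := by ring
  rw [e, Measure.addHaar_ball_mul_of_pos volume z (by norm_num : (0:ℝ) < 2⁻¹) ε,
    Measure.addHaar_ball_center volume y]
  congr 1
  rw [finrank_euclideanSpace_fin, ENNReal.ofReal_pow (by norm_num),
    ENNReal.ofReal_inv_of_pos (by norm_num), ENNReal.inv_pow]
  norm_num
end

section
/- Let M be a nonempty compact subset of ℝ^D with reach at least κ, and let 0 < σ < κ. Let S = M ⊕ σ. Then a ball of radius κ − σ rolls freely outside S: for every y in the topological frontier ∂S of S, there exists a ∈ ℝ^D such that y belongs to the closed ball of radius κ − σ centered at a and this closed ball is contained in the closure of the complement of S. -/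
open Metric MeasureTheory

theorem slope_aux {E : Type*} [NormedAddCommGroup E] [InnerProductSpace ℝ E] (M : Set E)
    (hM : M.Nonempty) (hMc : IsCompact M) (x : E) (hx : 0 < Metric.infDist x M)
    (hu : ∃! y, y ∈ M ∧ dist x y = Metric.infDist x M) (c : ℝ) (hc0 : 0 ≤ c) (hc : c < 1)
    (δ : ℝ) (hδ : 0 < δ) :
    ∃ x', dist x' x < δ ∧ Metric.infDist x M + c * dist x' x < Metric.infDist x' M := by
  obtain ⟨p, ⟨hpM, hp⟩, huniq⟩ := hu
  set r := Metric.infDist x M with hr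
  have hη : 0 < (1 - c) * r := mul_pos (by linarith) hx
  -- gap
  have gap : ∃ ε > 0, ∀ q ∈ M, dist x q < r + ε → dist q p < (1 - c) * r := by
    have hK : IsCompact (M \ Metric.ball p ((1 - c) * r)) := hMc.diff Metric.isOpen_ball
    rcases (M \ Metric.ball p ((1 - c) * r)).eq_empty_or_nonempty with he | hne
    · refine ⟨1, one_pos, fun q hq _ => ?_⟩
      by_contra h
      have : q ∈ M \ Metric.ball p ((1 - c) * r) := ⟨hq, h⟩
      rw [he] at this
      exact this
    · obtain ⟨k, hk, hkd⟩ := hK.exists_infDist_eq_dist hne x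
      have h1 : r ≤ dist x k := Metric.infDist_le_dist_of_mem hk.1
      have h2 : r ≠ dist x k := by
        intro h
        have := huniq k ⟨hk.1, h.symm⟩
        apply hk.2
        rw [this]
        exact Metric.mem_ball_self hη
      have h3 : r < dist x k := lt_of_le_of_ne h1 h2
      refine ⟨dist x k - r, by linarith, fun q hq hlt => ?_⟩
      by_contra h
      have hq' : q ∈ M \ Metric.ball p ((1 - c) * r) := ⟨hq, h⟩
      have := Metric.infDist_le_dist_of_mem (x := x) hq'
      linarith
  obtain ⟨ε, hε, hgap⟩ := gap
  set t := min (δ / 2) (ε / 3) with ht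
  have ht0 : 0 < t := lt_min (by linarith) (by linarith)
  have ht1 : t ≤ δ / 2 := min_le_left _ _
  have ht2 : t ≤ ε / 3 := min_le_right _ _
  set u : E := r⁻¹ • (x - p) with hudef
  have hxp : ‖x - p‖ = r := by rw [← dist_eq_norm, hp]
  have hun : ‖u‖ = 1 := by
    rw [hudef, norm_smul, hxp, norm_inv, Real.norm_of_nonneg hx.le, inv_mul_cancel₀ hx.ne']
  have hdist : dist (x + t • u) x = t := by
    rw [dist_eq_norm, add_sub_cancel_left, norm_smul, hun, Real.norm_of_nonneg ht0.le, mul_one]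
  refine ⟨x + t • u, by rw [hdist]; linarith, ?_⟩
  rw [hdist]
  obtain ⟨q, hq, hqd⟩ := hMc.exists_infDist_eq_dist hM (x + t • u)
  have h1 : Metric.infDist (x + t • u) M ≤ r + t := by
    have := Metric.infDist_le_infDist_add_dist (s := M) (x := x + t • u) (y := x)
    rw [hdist] at this
    exact this
  have h2 : dist x q ≤ t + (r + t) := by
    have := dist_triangle x (x + t • u) q
    rw [dist_comm x (x + t • u), hdist] at this
    linarith
  have h3 : dist q p < (1 - c) * r := hgap q hq (by linarith)
  have h4 : r ≤ ‖x - q‖ := by rw [← dist_eq_norm]; exact Metric.infDist_le_dist_of_mem hq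
  have h5 : inner ℝ (x - p) u = r := by
    rw [hudef, inner_smul_right, real_inner_self_eq_norm_sq, hxp]
    field_simp
  have h6 : inner ℝ (q - p) u < (1 - c) * r := by
    have := real_inner_le_norm (q - p) u
    rw [hun, mul_one, ← dist_eq_norm] at this
    linarith
  have h7 : inner ℝ (x - q) u = r - inner ℝ (q - p) u := by
    rw [← h5, ← inner_sub_left]; congr 1; abel
  have h8 : c * r < inner ℝ (x - q) u := by rw [h7]; linarith
  have h9 : ‖x + t • u - q‖ ^ 2 = ‖x - q‖ ^ 2 + 2 * (t * inner ℝ (x - q) u) + t ^ 2 := by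
    have : x + t • u - q = (x - q) + t • u := by abel
    rw [this, norm_add_sq_real, inner_smul_right, norm_smul, hun, Real.norm_of_nonneg ht0.le,
      mul_one]
  rw [hqd, dist_eq_norm]
  apply lt_of_pow_lt_pow_left₀ 2 (norm_nonneg _)
  rw [h9]
  have h10 : r ^ 2 ≤ ‖x - q‖ ^ 2 := by gcongr
  have h11 : t * (c * r) < t * inner ℝ (x - q) u := by gcongr
  have h12 : c ^ 2 * t ^ 2 ≤ t ^ 2 := by
    have : c ^ 2 ≤ 1 := by nlinarith
    nlinarith [sq_nonneg t]
  nlinarith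

/-- **A ball of radius `κ - σ` rolls freely outside the tube `S = M ⊕ σ`
(Lemma 17, second part).** If `M ⊆ ℝ^D` is nonempty, compact, with reach at least `κ`
(every point at distance `< κ` from `M` has a unique nearest point in `M`) and `0 < σ < κ`,
then for every `y` in the frontier of `S = M ⊕ σ` there is an `a` with
`y ∈ closedBall a (κ - σ) ⊆ closure Sᶜ`. -/
theorem tube_ball_rolls_freely_outside (D : ℕ) (M : Set (EuclideanSpace ℝ (Fin D)))
    (hM : M.Nonempty) (hMc : IsCompact M)
    (κ σ : ℝ) (hκ : 0 < κ) (hσ : 0 < σ) (hσκ : σ < κ)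
    (hreach : ∀ x : EuclideanSpace ℝ (Fin D), Metric.infDist x M < κ →
      ∃! y, y ∈ M ∧ dist x y = Metric.infDist x M) :
    ∀ y ∈ frontier (tubeNbhd M σ), ∃ a : EuclideanSpace ℝ (Fin D),
      y ∈ Metric.closedBall a (κ - σ) ∧
      Metric.closedBall a (κ - σ) ⊆ closure (tubeNbhd M σ)ᶜ := by
  intro y hy
  have hcont : Continuous fun x : EuclideanSpace ℝ (Fin D) => Metric.infDist x M :=
    Metric.continuous_infDist_pt M
  have hyσ : Metric.infDist y M = σ := frontier_le_subset_eq hcont continuous_const hy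
  have hR : 0 < κ - σ := by linarith
  have hcomp : IsCompact (Metric.closedBall y (κ - σ)) := isCompact_closedBall _ _
  have hymem : y ∈ Metric.closedBall y (κ - σ) := Metric.mem_closedBall_self hR.le
  obtain ⟨a, ha, hamax⟩ := hcomp.exists_isMaxOn ⟨y, hymem⟩ hcont.continuousOn
  have hmax : ∀ z ∈ Metric.closedBall y (κ - σ), Metric.infDist z M ≤ Metric.infDist a M :=
    fun z hz => hamax hz
  have hya := hmax y hymem
  have key : κ ≤ Metric.infDist a M := by
    by_contra! hlt
    obtain ⟨c, hc0, hc1, hcm⟩ : ∃ c : ℝ, 0 ≤ c ∧ c < 1 ∧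
        Metric.infDist a M < σ + c * (κ - σ) := by
      refine ⟨((Metric.infDist a M + κ) / 2 - σ) / (κ - σ), ?_, ?_, ?_⟩
      · apply div_nonneg <;> linarith
      · rw [div_lt_one hR]; linarith
      · rw [div_mul_cancel₀ _ hR.ne']; linarith
    have hfc : Continuous fun x : EuclideanSpace ℝ (Fin D) =>
      Metric.infDist x M - c * dist x y := by fun_prop
    obtain ⟨x, hx, hxmax⟩ := hcomp.exists_isMaxOn ⟨y, hymem⟩ hfc.continuousOn
    have hm : ∀ z ∈ Metric.closedBall y (κ - σ), Metric.infDist z M - c * dist z y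
      ≤ Metric.infDist x M - c * dist x y := fun z hz => hxmax hz
    have h1 := hm y hymem
    rw [dist_self, hyσ] at h1
    have hxa := hmax x hx
    have h0 : 0 ≤ c * dist x y := mul_nonneg hc0 dist_nonneg
    rw [Metric.mem_closedBall] at hx
    rcases hx.lt_or_eq with hlt' | heq
    · obtain ⟨x', hx'd, hx'⟩ := slope_aux M hM hMc x (by linarith)
        (hreach x (by linarith)) c hc0 hc1 (κ - σ - dist x y) (by linarith)
      have htri := dist_triangle x' x y
      have h2 := hm x' (by rw [Metric.mem_closedBall]; linarith)
      have h3 : c * dist x' y ≤ c * (dist x' x + dist x y) := by gcongr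
      linarith
    · rw [heq] at h1
      linarith
  refine ⟨a, by rw [Metric.mem_closedBall, dist_comm]; exact ha, ?_⟩
  rw [← closure_ball a hR.ne']
  apply closure_mono
  intro z hz hzS
  have hzS' : Metric.infDist z M ≤ σ := hzS
  have h1 := Metric.infDist_le_infDist_add_dist (s := M) (x := a) (y := z)
  rw [Metric.mem_ball, dist_comm] at hz
  linarith
end

section
/- Let M be a nonempty compact subset of ℝ^D with empty interior and reach at least κ, and let 0 < σ < κ. Let S = M ⊕ σ and let ∂S denote the topological frontier of S. Then for every y ∈ S, infDist(y, ∂S) = σ − infDist(y, M). -/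
open Metric MeasureTheory

open Filter Topology in
lemma tube_slope {D : ℕ} (M : Set (EuclideanSpace ℝ (Fin D)))
    (hM : M.Nonempty) (hMc : IsCompact M) (κ : ℝ)
    (hreach : ∀ x : EuclideanSpace ℝ (Fin D), Metric.infDist x M < κ →
      ∃! y, y ∈ M ∧ dist x y = Metric.infDist x M)
    (x : EuclideanSpace ℝ (Fin D)) (hx0 : 0 < infDist x M) (hxκ : infDist x M < κ)
    (ε : ℝ) (hε : 0 < ε) (hε1 : ε < 1) (r : ℝ) (hr : 0 < r) :
    ∃ z, dist z x < r ∧ infDist x M < infDist z M ∧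
      (1 - ε) * dist z x ≤ infDist z M - infDist x M := by
  obtain ⟨p, ⟨hpM, hp⟩, huniq⟩ := hreach x hxκ
  set d := infDist x M with hd
  set w := x - p with hw
  have hwn : ‖w‖ = d := by rw [hw, ← dist_eq_norm, hp]
  have hq : ∀ n : ℕ, ∃ q ∈ M, infDist (x + (1 / ((n:ℝ) + 1)) • w) M
      = dist (x + (1 / ((n:ℝ) + 1)) • w) q := fun n => hMc.exists_infDist_eq_dist hM _
  choose q hqM hqd using hq
  obtain ⟨q0, hq0M, φ, hφ, hlim⟩ := hMc.tendsto_subseq hqM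
  have hs : Tendsto (fun n : ℕ => 1 / ((φ n : ℝ) + 1)) atTop (𝓝 0) :=
    (tendsto_one_div_add_atTop_nhds_zero_nat (𝕜 := ℝ)).comp hφ.tendsto_atTop
  have hz : Tendsto (fun n : ℕ => x + (1 / ((φ n : ℝ) + 1)) • w) atTop (𝓝 x) := by
    have := (hs.smul_const w).const_add x
    simpa using this
  have h1 : Tendsto (fun n => infDist (x + (1 / ((φ n : ℝ) + 1)) • w) M) atTop (𝓝 d) :=
    ((continuous_infDist_pt M).tendsto x).comp hz
  have h2 : Tendsto (fun n => infDist (x + (1 / ((φ n : ℝ) + 1)) • w) M) atTop (𝓝 (dist x q0)) := by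
    refine (hz.dist hlim).congr fun n => ?_
    exact (hqd (φ n)).symm
  have hq0 : q0 = p := huniq q0 ⟨hq0M, tendsto_nhds_unique h2 h1⟩
  subst hq0
  have h3 : Tendsto (fun n => inner ℝ (x - q (φ n)) w) atTop (𝓝 (inner ℝ w w)) :=
    (hlim.const_sub x).inner tendsto_const_nhds
  rw [real_inner_self_eq_norm_sq, hwn] at h3
  have h4 : ∀ᶠ n in atTop, (1 - ε) * d ^ 2 < inner ℝ (x - q (φ n)) w :=
    h3.eventually (lt_mem_nhds (by nlinarith [pow_pos hx0 2]))
  have h5 : ∀ᶠ n in atTop, dist (x + (1 / ((φ n : ℝ) + 1)) • w) x < r :=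
    hz.eventually (ball_mem_nhds x hr)
  obtain ⟨n, hn4, hn5⟩ := (h4.and h5).exists
  have hqd' := hqd (φ n)
  have hqM' := hqM (φ n)
  have hs0 : 0 < 1 / ((φ n : ℝ) + 1) := by positivity
  generalize 1 / ((φ n : ℝ) + 1) = s at *
  generalize q (φ n) = q' at *
  have hdist : dist (x + s • w) x = s * d := by
    rw [dist_eq_norm, add_sub_cancel_left, norm_smul, hwn, Real.norm_eq_abs, abs_of_pos hs0]
  have hxq : d ≤ ‖x - q'‖ := by rw [← dist_eq_norm]; exact infDist_le_dist_of_mem hqM'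
  have hsq : (infDist (x + s • w) M) ^ 2 =
      ‖x - q'‖ ^ 2 + 2 * (s * inner ℝ (x - q') w) + (s * d) ^ 2 := by
    rw [hqd', dist_eq_norm, show x + s • w - q' = (x - q') + s • w by abel,
      norm_add_sq_real, inner_smul_right, norm_smul, hwn, Real.norm_eq_abs, abs_of_pos hs0]
  have hnn : 0 ≤ infDist (x + s • w) M := infDist_nonneg
  have hsd : 0 < s * d := mul_pos hs0 hx0
  have key : d + (1 - ε) * (s * d) ≤ infDist (x + s • w) M := by
    apply le_of_sq_le_sq _ hnn
    rw [hsq]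
    have a1 : d ^ 2 ≤ ‖x - q'‖ ^ 2 := by gcongr
    have a2 : s * ((1 - ε) * d ^ 2) ≤ s * inner ℝ (x - q') w := by gcongr
    have a3 : ((1 - ε) * (s * d)) ^ 2 ≤ (s * d) ^ 2 := by
      apply pow_le_pow_left₀
      · exact mul_nonneg (by linarith) hsd.le
      · nlinarith
    nlinarith
  refine ⟨x + s • w, hn5, ?_, ?_⟩
  · have : 0 < (1 - ε) * (s * d) := mul_pos (by linarith) hsd
    linarith
  · rw [hdist]; linarith

lemma tube_climb {D : ℕ} (M : Set (EuclideanSpace ℝ (Fin D)))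
    (hM : M.Nonempty) (hMc : IsCompact M) (κ σ : ℝ) (hσκ : σ < κ)
    (hreach : ∀ x : EuclideanSpace ℝ (Fin D), Metric.infDist x M < κ →
      ∃! y, y ∈ M ∧ dist x y = Metric.infDist x M)
    (y : EuclideanSpace ℝ (Fin D)) (hy0 : 0 < infDist y M) (hyσ : infDist y M ≤ σ)
    (ε : ℝ) (hε : 0 < ε) (hε1 : ε < 1) :
    ∃ z ∈ frontier (tubeNbhd M σ), (1 - ε) * dist z y ≤ σ - infDist y M := by
  have hc := continuous_infDist_pt M
  set A : Set (EuclideanSpace ℝ (Fin D)) :=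
    {z | (1 - ε) * dist z y ≤ infDist z M - infDist y M ∧ infDist z M ≤ σ} with hA
  have hAc : IsClosed A :=
    IsClosed.inter
      (isClosed_le (continuous_const.mul (continuous_id.dist continuous_const))
        (hc.sub continuous_const)) (isClosed_le hc continuous_const)
  have hAb : A ⊆ closedBall y ((σ - infDist y M) / (1 - ε)) := by
    rintro z ⟨h1, h2⟩
    rw [mem_closedBall, le_div_iff₀ (by linarith)]
    linarith
  have hAk : IsCompact A := (isCompact_closedBall _ _).of_isClosed_subset hAc hAb
  obtain ⟨z, ⟨hz1, hz2⟩, hmax⟩ := hAk.exists_isMaxOn ⟨y, by simp [hA, hyσ]⟩ hc.continuousOn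
  have hz0 : infDist y M ≤ infDist z M := by
    have : 0 ≤ (1 - ε) * dist z y := mul_nonneg (by linarith) dist_nonneg
    linarith
  have hzσ : infDist z M = σ := by
    by_contra hne
    have hlt := lt_of_le_of_ne hz2 hne
    obtain ⟨z', h1, h2, h3⟩ := tube_slope M hM hMc κ hreach z (by linarith) (by linarith)
      ε hε hε1 (σ - infDist z M) (by linarith)
    have hmem : z' ∈ A := by
      refine ⟨?_, ?_⟩
      · have := mul_le_mul_of_nonneg_left (dist_triangle z' z y) (by linarith : 0 ≤ 1 - ε)
        linarith
      · have := infDist_le_infDist_add_dist (s := M) (x := z') (y := z)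
        linarith
    have : infDist z' M ≤ infDist z M := hmax hmem
    linarith
  refine ⟨z, ⟨subset_closure hz2, ?_⟩, by linarith⟩
  intro hint
  obtain ⟨r, hr, hball⟩ := Metric.isOpen_iff.1 isOpen_interior z hint
  obtain ⟨z', h1, h2, -⟩ := tube_slope M hM hMc κ hreach z (by linarith) (by linarith)
      ε hε hε1 r hr
  have hz' : z' ∈ tubeNbhd M σ := interior_subset (hball h1)
  have : infDist z' M ≤ σ := hz'
  linarith

/-- **Distance to the boundary of the tube (used in Lemmas 16 and 17).**
If `M ⊆ ℝ^D` is nonempty, compact, with empty interior and reach at least `κ`, and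
`0 < σ < κ`, then for every `y` in the tube `S = M ⊕ σ`,
`infDist(y, ∂S) = σ - infDist(y, M)`. -/
theorem tube_dist_to_frontier (D : ℕ) (M : Set (EuclideanSpace ℝ (Fin D)))
    (hM : M.Nonempty) (hMc : IsCompact M) (hMi : interior M = ∅)
    (κ σ : ℝ) (hκ : 0 < κ) (hσ : 0 < σ) (hσκ : σ < κ)
    (hreach : ∀ x : EuclideanSpace ℝ (Fin D), Metric.infDist x M < κ →
      ∃! y, y ∈ M ∧ dist x y = Metric.infDist x M) :
    ∀ y ∈ tubeNbhd M σ,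
      Metric.infDist y (frontier (tubeNbhd M σ)) = σ - Metric.infDist y M := by
  intro y hy
  have hyσ : infDist y M ≤ σ := hy
  have hc := continuous_infDist_pt M
  -- points of positive distance near `y`
  have hnear : ∀ η > 0, ∃ y', dist y y' < η ∧ 0 < infDist y' M := by
    intro η hη
    by_contra! hcon
    have hsub : ball y η ⊆ M := by
      intro v hv
      have h0 : infDist v M = 0 :=
        le_antisymm (hcon v (by rw [dist_comm]; exact hv)) infDist_nonneg
      exact (hMc.isClosed.mem_iff_infDist_zero hM).2 h0
    have : y ∈ interior M := mem_interior.2 ⟨_, hsub, isOpen_ball, mem_ball_self hη⟩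
    rw [hMi] at this
    exact this
  have hup : ∀ y', 0 < infDist y' M → infDist y' M ≤ σ →
      infDist y' (frontier (tubeNbhd M σ)) ≤ σ - infDist y' M := by
    intro y' h0 h1
    have hall : ∀ ε : ℝ, ε ∈ Set.Ioo (0:ℝ) 1 →
        (1 - ε) * infDist y' (frontier (tubeNbhd M σ)) ≤ σ - infDist y' M := by
      rintro ε ⟨he, he1⟩
      obtain ⟨z, hz, hzd⟩ := tube_climb M hM hMc κ σ hσκ hreach y' h0 h1 ε he he1
      refine le_trans (mul_le_mul_of_nonneg_left ?_ (by linarith)) hzd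
      rw [dist_comm]
      exact infDist_le_dist_of_mem hz
    have hcl : (0:ℝ) ∈ closure (Set.Ioo (0:ℝ) 1) := by
      rw [closure_Ioo (by norm_num)]; simp
    have := closure_minimal (t := {ε : ℝ | (1 - ε) * infDist y' (frontier (tubeNbhd M σ))
      ≤ σ - infDist y' M}) hall (isClosed_le (by fun_prop) continuous_const) hcl
    simpa using this
  have hne : (frontier (tubeNbhd M σ)).Nonempty := by
    rcases lt_or_eq_of_le (infDist_nonneg (x := y) (s := M)) with h | h
    · obtain ⟨z, hz, -⟩ := tube_climb M hM hMc κ σ hσκ hreach y h hyσ (1/2)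
        (by norm_num) (by norm_num)
      exact ⟨z, hz⟩
    · obtain ⟨y', h1, h2⟩ := hnear σ hσ
      have := infDist_le_infDist_add_dist (s := M) (x := y') (y := y)
      rw [dist_comm] at this
      obtain ⟨z, hz, -⟩ := tube_climb M hM hMc κ σ hσκ hreach y' h2 (by linarith) (1/2)
        (by norm_num) (by norm_num)
      exact ⟨z, hz⟩
  apply le_antisymm
  · rcases lt_or_eq_of_le (infDist_nonneg (x := y) (s := M)) with h | h
    · exact hup y h hyσ
    · apply le_of_forall_pos_le_add
      intro η hη
      obtain ⟨y', h1, h2⟩ := hnear (min η σ) (lt_min hη hσ)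
      have h3 := infDist_le_infDist_add_dist (s := M) (x := y') (y := y)
      have h4 := infDist_le_infDist_add_dist (s := frontier (tubeNbhd M σ)) (x := y) (y := y')
      rw [dist_comm] at h3
      have h5 := lt_of_lt_of_le h1 (min_le_left _ _)
      have h6 := lt_of_lt_of_le h1 (min_le_right _ _)
      have := hup y' h2 (by linarith)
      linarith
  · rw [le_infDist hne]
    intro z hz
    have hzσ : infDist z M = σ := frontier_le_subset_eq hc continuous_const hz
    have := infDist_le_infDist_add_dist (s := M) (x := z) (y := y)
    rw [dist_comm] at this
    linarith
end
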